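/- There exist R₀ > 0, a real s > 1 with s·ρ(P) < 1, and C' ≥ 1 such that: whenever x, y ∈ Γ and v ∈ Γ lies on a geodesic segment α ∈ [x,y] with N(α,R₀) ⊂ Δ ⊂ Γ, one has G_Δ(x,w) ≤ C' · F_Δ(x,v) · G_Δ(v,w|s) for every w ∈ Δ ∩ N(U_{x,v,y}, 1), where U_{x,v,y} = {g ∈ Γ : (g|y)_x > d(x,v)}. -/

import Mathlib

open Filter Topology MeasureTheory
open scoped ENNReal

namespace HarmonicBoundary

variable {Γ : Type} [Group Γ]

/-- Word length of `g` with respect to a generating set `S`. -/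
noncomputable def wl (S : Set Γ) (g : Γ) : ℕ :=
  sInf {n : ℕ | ∃ w : List Γ, w.length = n ∧ (∀ x ∈ w, x ∈ S) ∧ w.prod = g}

/-- Word metric `d(x,y) = |x⁻¹y|`. -/
noncomputable def wdist (S : Set Γ) (x y : Γ) : ℕ := wl S (x⁻¹ * y)

/-- Gromov product `(x|y)_z = (d(x,z)+d(y,z)-d(x,y))/2`. -/
noncomputable def gp (S : Set Γ) (z x y : Γ) : ℝ :=
  ((wdist S x z : ℝ) + (wdist S y z : ℝ) - (wdist S x y : ℝ)) / 2

/-- `S` is a finite symmetric generating set of `Γ`. -/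
def IsGenSet (S : Set Γ) : Prop :=
  S.Finite ∧ (∀ s ∈ S, s⁻¹ ∈ S) ∧ Subgroup.closure S = ⊤

/-- `Γ` is `δ`-hyperbolic with respect to the word metric of `S`:
`(x|y) ≥ min ((x|z), (y|z)) - δ` for all `x y z`. -/
def IsHyperbolic (S : Set Γ) (δ : ℝ) : Prop :=
  0 ≤ δ ∧ ∀ x y z : Γ, min (gp S 1 x z) (gp S 1 y z) - δ ≤ gp S 1 x y

/-- `Γ` is nonelementary: it has no cyclic subgroup of finite index. -/
def Nonelementary (Γ : Type) [Group Γ] : Prop :=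
  ∀ g : Γ, (Subgroup.zpowers g).index = 0

/-- A sequence converges to infinity if `(x_i|x_j) → ∞`. -/
def ConvInf (S : Set Γ) (u : ℕ → Γ) : Prop :=
  Tendsto (fun p : ℕ × ℕ => gp S 1 (u p.1) (u p.2)) atTop atTop

/-- Two sequences converging to infinity are equivalent if `(x_i|y_j) → ∞`. -/
def EquivSeq (S : Set Γ) (u v : ℕ → Γ) : Prop :=
  Tendsto (fun p : ℕ × ℕ => gp S 1 (u p.1) (v p.2)) atTop atTop

/-- An (abstract model of the) Gromov boundary of `Γ`: the points are exactly the
classes of sequences converging to infinity, modulo the equivalence `EquivSeq`,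
together with the natural left action of `Γ`. -/
structure Boundary (Γ : Type) [Group Γ] (S : Set Γ) where
  pt : Type
  cls : (ℕ → Γ) → pt
  cls_surj : ∀ ξ : pt, ∃ u : ℕ → Γ, ConvInf S u ∧ cls u = ξ
  cls_eq : ∀ u v : ℕ → Γ, ConvInf S u → ConvInf S v → (cls u = cls v ↔ EquivSeq S u v)
  smul : Γ → pt → pt
  smul_cls : ∀ (g : Γ) (u : ℕ → Γ), ConvInf S u → smul g (cls u) = cls fun n => g * u n

/-- Extension of the Gromov product to the boundary:
`(ξ|η) = sup liminf (x_i|y_j)` over sequences representing `ξ` and `η`,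
as an extended nonnegative real. -/
noncomputable def bgp {S : Set Γ} (B : Boundary Γ S) (ξ η : B.pt) : ℝ≥0∞ :=
  ⨆ (u : {u : ℕ → Γ // ConvInf S u ∧ B.cls u = ξ})
    (v : {v : ℕ → Γ // ConvInf S v ∧ B.cls v = η}),
    Filter.liminf (fun p : ℕ × ℕ => ENNReal.ofReal (gp S 1 (u.1 p.1) (v.1 p.2))) atTop

/-- Real-valued Gromov product on the boundary (finite for `ξ ≠ η`). -/
noncomputable def bgpR {S : Set Γ} (B : Boundary Γ S) (ξ η : B.pt) : ℝ := (bgp B ξ η).toReal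

/-- The canonical topology of the Gromov boundary: a set is open iff around each of
its points it contains a basic neighbourhood `V_r(p) = {q | (q|p) > r}`. -/
def btop {S : Set Γ} (B : Boundary Γ S) : TopologicalSpace B.pt where
  IsOpen O := ∀ p ∈ O, ∃ r : ℝ≥0∞, r ≠ ⊤ ∧ {q | r < bgp B q p} ⊆ O
  isOpen_univ := fun p _ => ⟨0, ENNReal.zero_ne_top, fun q _ => trivial⟩
  isOpen_inter := by
    intro A A' hA hA' p hp
    obtain ⟨r1, hr1, h1⟩ := hA p hp.1
    obtain ⟨r2, hr2, h2⟩ := hA' p hp.2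
    refine ⟨max r1 r2, (max_lt hr1.lt_top hr2.lt_top).ne, fun q hq => ?_⟩
    have hq' : max r1 r2 < bgp B q p := hq
    exact ⟨h1 (show r1 < bgp B q p from (le_max_left r1 r2).trans_lt hq'),
      h2 (show r2 < bgp B q p from (le_max_right r1 r2).trans_lt hq')⟩
  isOpen_sUnion := by
    intro s hs p hp
    obtain ⟨t, ht, hpt⟩ := hp
    obtain ⟨r, hr, hsub⟩ := hs t ht p hpt
    exact ⟨r, hr, fun q hq => ⟨t, ht, hsub hq⟩⟩

/-- The attracting fixed point `g⁺ = lim_n gⁿ` of an (infinite order) element. -/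
def plusPt {S : Set Γ} (B : Boundary Γ S) (g : Γ) : B.pt := B.cls fun n => g ^ n

/-- The repelling fixed point `g⁻ = lim_n g⁻ⁿ` of an (infinite order) element. -/
def minusPt {S : Set Γ} (B : Boundary Γ S) (g : Γ) : B.pt := B.cls fun n => g⁻¹ ^ n

/-- A geodesic ray starting at the identity. -/
def IsGeodesicRay (S : Set Γ) (x : ℕ → Γ) : Prop :=
  x 0 = 1 ∧ ∀ m n : ℕ, wdist S (x m) (x n) = Nat.dist m n

/-- A geodesic ray from `e` to the boundary point `ξ`, i.e. an element of `[e,ξ]`. -/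
def RayTo {S : Set Γ} (B : Boundary Γ S) (x : ℕ → Γ) (ξ : B.pt) : Prop :=
  IsGeodesicRay S x ∧ ConvInf S x ∧ B.cls x = ξ

/-- A geodesic segment from `x` to `y` (parametrized on `0,…,d(x,y)`),
i.e. an element of `[x,y]`. -/
def IsGeodesicSeg (S : Set Γ) (x y : Γ) (α : ℕ → Γ) : Prop :=
  α 0 = x ∧ α (wdist S x y) = y ∧
  ∀ m n : ℕ, m ≤ wdist S x y → n ≤ wdist S x y → wdist S (α m) (α n) = Nat.dist m n

/-- The boundary "cylinder" `U(ξ,R)`: all `η` such that for every pair of geodesic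
rays `x ∈ [e,ξ]`, `y ∈ [e,η]` one has `lim_n (x(n)|y(n)) > R` (the sequence
`(x(n)|y(n))` is nondecreasing, so the limit exceeds `R` iff some term does). -/
def Uset {S : Set Γ} (B : Boundary Γ S) (ξ : B.pt) (R : ℝ) : Set B.pt :=
  {η | ∀ x y : ℕ → Γ, RayTo B x ξ → RayTo B y η → ∃ n : ℕ, R < gp S 1 (x n) (y n)}

/-- `C_r(p) = {g | (g|e)_p > r}`. -/
def Cset (S : Set Γ) (p : Γ) (r : ℝ) : Set Γ := {g | r < gp S p g 1}

/-- The `R`-neighbourhood `N(α,R)` of a geodesic segment `α ∈ [x,y]`. -/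
def segN (S : Set Γ) (x y : Γ) (α : ℕ → Γ) (R : ℝ) : Set Γ :=
  {g | ∃ i ≤ wdist S x y, (wdist S g (α i) : ℝ) ≤ R}

/-- The `R`-neighbourhood `N(A,R)` of a subset `A ⊆ Γ`. -/
def setN (S : Set Γ) (A : Set Γ) (R : ℝ) : Set Γ :=
  {g | ∃ a ∈ A, (wdist S g a : ℝ) ≤ R}

/-- `μ` is a nondegenerate probability measure on `Γ` with support contained in `S`:
nonnegative, of total mass one, supported in `S`, and the semigroup generated by its
support is the whole of `Γ`. -/
structure IsRWMeasure (S : Set Γ) (μ : Γ → ℝ) : Prop where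
  nonneg : ∀ g, 0 ≤ μ g
  support_subset : ∀ g, μ g ≠ 0 → g ∈ S
  total : ∑' g : Γ, μ g = 1
  nondeg : ∀ g : Γ, ∃ l : List Γ, l ≠ [] ∧ (∀ x ∈ l, 0 < μ x) ∧ l.prod = g

open Classical in
/-- `n`-step transition probabilities `p⁽ⁿ⁾(x,y) = μ*ⁿ(x⁻¹y)` of the random walk. -/
noncomputable def ptrans (μ : Γ → ℝ) : ℕ → Γ → Γ → ℝ
  | 0 => fun x y => if x = y then 1 else 0
  | n + 1 => fun x y => ∑' z : Γ, ptrans μ n x z * μ (z⁻¹ * y)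

/-- Green function `G(x,y) = Σ_n p⁽ⁿ⁾(x,y)`. -/
noncomputable def green (μ : Γ → ℝ) (x y : Γ) : ℝ := ∑' n : ℕ, ptrans μ n x y

/-- `F(x,y) = G(x,y)/G(y,y)`, the probability that the walk from `x` ever hits `y`. -/
noncomputable def greenF (μ : Γ → ℝ) (x y : Γ) : ℝ := green μ x y / green μ y y

/-- The Martin kernel `K(x,y) = G(x,y)/G(e,y)`. -/
noncomputable def martinK (μ : Γ → ℝ) (x y : Γ) : ℝ := green μ x y / green μ 1 y

open Classical in
/-- Transition probabilities of the walk restricted to `Δ` (killed when leaving `Δ`). -/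
noncomputable def ptransR (μ : Γ → ℝ) (Δ : Set Γ) : ℕ → Γ → Γ → ℝ
  | 0 => fun x y => if x = y ∧ x ∈ Δ then 1 else 0
  | n + 1 => fun x y => if y ∈ Δ then ∑' z : Γ, ptransR μ Δ n x z * μ (z⁻¹ * y) else 0

/-- Green function `G_Δ` of the restricted walk. -/
noncomputable def greenR (μ : Γ → ℝ) (Δ : Set Γ) (x y : Γ) : ℝ := ∑' n : ℕ, ptransR μ Δ n x y

/-- `F_Δ(x,y) = G_Δ(x,y)/G_Δ(y,y)`. -/
noncomputable def greenFR (μ : Γ → ℝ) (Δ : Set Γ) (x y : Γ) : ℝ :=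
  greenR μ Δ x y / greenR μ Δ y y

/-- Generating function `G_Δ(x,y|z) = Σ_n p_Δ⁽ⁿ⁾(x,y) zⁿ`. -/
noncomputable def greenRZ (μ : Γ → ℝ) (Δ : Set Γ) (x y : Γ) (z : ℝ) : ℝ :=
  ∑' n : ℕ, ptransR μ Δ n x y * z ^ n

/-- Spectral radius `ρ(P) = lim_n p⁽ⁿ⁾(e,e)^{1/n}` of the walk. -/
noncomputable def specRad (μ : Γ → ℝ) : ℝ :=
  Filter.limsup (fun n : ℕ => (ptrans μ n 1 1) ^ ((n : ℝ)⁻¹)) atTop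

/-- `u` is harmonic on `Λ`: `Σ_h p(g,h) u(h) = u(g)` for `g ∈ Λ`, `p(g,h)=μ(g⁻¹h)`. -/
def HarmonicOn (μ : Γ → ℝ) (u : Γ → ℝ) (Λ : Set Γ) : Prop :=
  ∀ g ∈ Λ, (∑' h : Γ, μ (g⁻¹ * h) * u h) = u g

/-- `u` vanishes at infinity on `Λ`: `u(g_n) → 0` along sequences in `Λ` with `|g_n|→∞`. -/
def VanishesAtInftyOn (S : Set Γ) (u : Γ → ℝ) (Λ : Set Γ) : Prop :=
  ∀ ε : ℝ, 0 < ε → ∃ M : ℕ, ∀ g ∈ Λ, M ≤ wl S g → |u g| ≤ ε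

open Classical in
/-- `r(g) = K(g⁻¹,g⁺)` for infinite order `g`, and `r(g) = 1` for finite order `g`;
here `Kb` is the boundary extension of the Martin kernel. -/
noncomputable def rfun {S : Set Γ} (B : Boundary Γ S) (Kb : Γ → B.pt → ℝ) (g : Γ) : ℝ :=
  if IsOfFinOrder g then 1 else Kb g⁻¹ (plusPt B g)

/-- The ratio set `r(Γ,∂Γ,ν)`: all `l ≥ 0` such that for every `ε > 0` and every
Borel `A` of positive measure there is `g ∈ Γ` such that
`{ω ∈ gA ∩ A : |d(gν)/dν(ω) − l| < ε}` has positive measure; here the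
Radon–Nikodym derivative `d(gν)/dν` is the Martin kernel `Kb g`. -/
def ratioSet {S : Set Γ} (B : Boundary Γ S) [MeasurableSpace B.pt]
    (ν : Measure B.pt) (Kb : Γ → B.pt → ℝ) : Set ℝ :=
  {l : ℝ | 0 ≤ l ∧ ∀ ε : ℝ, 0 < ε → ∀ A : Set B.pt, MeasurableSet A → 0 < ν A →
    ∃ g : Γ, 0 < ν {ω | ω ∈ A ∧ B.smul g⁻¹ ω ∈ A ∧ |Kb g ω - l| < ε}}

/-- A left invariant finitely additive mean on `Γ`; `Γ` is amenable iff one exists. -/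
structure InvariantMean (Γ : Type) [Group Γ] where
  m : Set Γ → ℝ
  nonneg : ∀ A, 0 ≤ m A
  total : m Set.univ = 1
  fin_add : ∀ A B : Set Γ, Disjoint A B → m (A ∪ B) = m A + m B
  invariant : ∀ (g : Γ) (A : Set Γ), m ((g * ·) ⁻¹' A) = m A

/-! Word metric basics -/

theorem wl_exists {S : Set Γ} (hS : IsGenSet S) (g : Γ) :
    ∃ w : List Γ, (∀ x ∈ w, x ∈ S) ∧ w.prod = g := by
  have h : g ∈ Subgroup.closure S := by rw [hS.2.2]; trivial
  rw [← Subgroup.mem_toSubmonoid, Subgroup.closure_toSubmonoid] at h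
  obtain ⟨l, hl, hp⟩ := Submonoid.exists_list_of_mem_closure h
  refine ⟨l, fun x hx => ?_, hp⟩
  rcases hl x hx with h | h
  · exact h
  · simpa using hS.2.1 _ h

theorem wl_spec {S : Set Γ} (hS : IsGenSet S) (g : Γ) :
    ∃ w : List Γ, w.length = wl S g ∧ (∀ x ∈ w, x ∈ S) ∧ w.prod = g := by
  have : ({n : ℕ | ∃ w : List Γ, w.length = n ∧ (∀ x ∈ w, x ∈ S) ∧ w.prod = g}).Nonempty := by
    obtain ⟨w, h1, h2⟩ := wl_exists hS g
    exact ⟨w.length, w, rfl, h1, h2⟩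
  exact Nat.sInf_mem this

theorem wl_le {S : Set Γ} (w : List Γ) (h : ∀ x ∈ w, x ∈ S) : wl S w.prod ≤ w.length :=
  Nat.sInf_le ⟨w, rfl, h, rfl⟩

theorem wl_one {S : Set Γ} : wl S (1 : Γ) = 0 := by
  have := wl_le (S := S) ([] : List Γ) (by simp)
  simpa using this

theorem wl_mul {S : Set Γ} (hS : IsGenSet S) (g h : Γ) : wl S (g * h) ≤ wl S g + wl S h := by
  obtain ⟨a, ha, ha1, ha2⟩ := wl_spec hS g
  obtain ⟨b, hb, hb1, hb2⟩ := wl_spec hS h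
  have := wl_le (S := S) (a ++ b) (by
    intro x hx
    rcases List.mem_append.1 hx with h | h
    · exact ha1 x h
    · exact hb1 x h)
  rw [List.prod_append, ha2, hb2, List.length_append, ha, hb] at this
  exact this

theorem wl_inv_le {S : Set Γ} (hS : IsGenSet S) (g : Γ) : wl S g⁻¹ ≤ wl S g := by
  obtain ⟨a, ha, ha1, ha2⟩ := wl_spec hS g
  have := wl_le (S := S) ((a.map fun x => x⁻¹).reverse) (by
    intro x hx
    rw [List.mem_reverse, List.mem_map] at hx
    obtain ⟨y, hy, rfl⟩ := hx
    exact hS.2.1 y (ha1 y hy))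
  rw [← List.prod_inv_reverse, ha2] at this
  simpa [ha] using this

theorem wl_inv {S : Set Γ} (hS : IsGenSet S) (g : Γ) : wl S g⁻¹ = wl S g :=
  le_antisymm (wl_inv_le hS g) (by simpa using wl_inv_le hS g⁻¹)

theorem wl_eq_zero {S : Set Γ} (hS : IsGenSet S) {g : Γ} (h : wl S g = 0) : g = 1 := by
  obtain ⟨a, ha, ha1, ha2⟩ := wl_spec hS g
  rw [h] at ha
  rw [← ha2, List.length_eq_zero_iff.1 ha]; rfl

theorem wl_mem {S : Set Γ} {g : Γ} (h : g ∈ S) : wl S g ≤ 1 := by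
  simpa using wl_le (S := S) [g] (by simpa using h)

theorem ball_finite {S : Set Γ} (hS : IsGenSet S) (n : ℕ) : {g : Γ | wl S g ≤ n}.Finite := by
  induction n with
  | zero =>
    refine (Set.finite_singleton (1 : Γ)).subset fun g hg => ?_
    exact wl_eq_zero hS (Nat.le_zero.1 hg)
  | succ n ih =>
    refine (ih.union (hS.1.mul ih)).subset fun g hg => ?_
    obtain ⟨a, ha, ha1, ha2⟩ := wl_spec hS g
    cases a with
    | nil =>
      left
      simp at ha
      simp [← ha]
    | cons s l =>
      right
      refine ⟨s, ha1 s (by simp), l.prod, ?_, by simpa using ha2⟩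
      have h1 := wl_le (S := S) l (fun x hx => ha1 x (by simp [hx]))
      have h2 : wl S g ≤ n + 1 := hg
      simp only [List.length_cons] at ha
      show wl S l.prod ≤ n
      omega

/-- The ball of radius `n` as a finset. -/
noncomputable def ballF {S : Set Γ} (hS : IsGenSet S) (n : ℕ) : Finset Γ :=
  (ball_finite hS n).toFinset

theorem mem_ballF {S : Set Γ} (hS : IsGenSet S) {n : ℕ} {g : Γ} :
    g ∈ ballF hS n ↔ wl S g ≤ n := by
  simp [ballF]

theorem gp_one {S : Set Γ} (hS : IsGenSet S) (x y : Γ) :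
    gp S 1 x y = ((wl S x : ℝ) + wl S y - wl S (x⁻¹ * y)) / 2 := by
  simp only [gp, wdist, mul_one, wl_inv hS]

theorem gp_base {S : Set Γ} (z x y : Γ) : gp S z x y = gp S 1 (z⁻¹ * x) (z⁻¹ * y) := by
  simp only [gp, wdist, mul_inv_rev, inv_inv, mul_one, mul_assoc, mul_inv_cancel_left]

theorem wl_inv_mul_comm {S : Set Γ} (hS : IsGenSet S) (x y : Γ) :
    wl S (x⁻¹ * y) = wl S (y⁻¹ * x) := by
  rw [← wl_inv hS]; simp

theorem gp_comm {S : Set Γ} (hS : IsGenSet S) (x y : Γ) : gp S 1 x y = gp S 1 y x := by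
  rw [gp_one hS, gp_one hS, wl_inv_mul_comm hS x y]; ring

theorem wl_tri {S : Set Γ} (hS : IsGenSet S) (x y z : Γ) :
    wl S (x⁻¹ * z) ≤ wl S (x⁻¹ * y) + wl S (y⁻¹ * z) := by
  have := wl_mul hS (x⁻¹ * y) (y⁻¹ * z)
  simpa [mul_assoc] using this

theorem gp_le_left {S : Set Γ} (hS : IsGenSet S) (x y : Γ) : gp S 1 x y ≤ wl S x := by
  rw [gp_one hS]
  have h := wl_mul hS x (x⁻¹ * y)
  rw [mul_inv_cancel_left] at h
  have : (wl S y : ℝ) ≤ wl S x + wl S (x⁻¹ * y) := by exact_mod_cast h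
  linarith

theorem gp_le_right {S : Set Γ} (hS : IsGenSet S) (x y : Γ) : gp S 1 x y ≤ wl S y := by
  rw [gp_comm hS]; exact gp_le_left hS y x

theorem gp_nonneg {S : Set Γ} (hS : IsGenSet S) (x y : Γ) : 0 ≤ gp S 1 x y := by
  rw [gp_one hS]
  have h := wl_mul hS x⁻¹ y
  rw [wl_inv hS] at h
  have : (wl S (x⁻¹ * y) : ℝ) ≤ wl S x + wl S y := by exact_mod_cast h
  linarith

/-- translation identity `(t|tw) = |t| - (t⁻¹|w)` -/
theorem gp_shift {S : Set Γ} (hS : IsGenSet S) (t w : Γ) :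
    gp S 1 t (t * w) = wl S t - gp S 1 t⁻¹ w := by
  rw [gp_one hS, gp_one hS, wl_inv hS]
  simp only [inv_mul_cancel_left, inv_inv]; ring

/-- Hyperbolicity in the useful form: if `(x|z)` is big then `(y|z)` is bounded by `(x|y)+δ`. -/
theorem hyp_le {S : Set Γ} {δ : ℝ} (hδ : IsHyperbolic S δ) {x y z : Γ} {a : ℝ}
    (h : gp S 1 x y ≤ a) (h2 : a + δ < gp S 1 x z) : gp S 1 y z ≤ a + δ := by
  have := hδ.2 x y z
  by_contra hc
  push Not at hc
  have := lt_min h2 hc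
  linarith

/-- A geodesic of length `N` read along a word. -/
theorem exists_geod_of {S : Set Γ} (hS : IsGenSet S) (g : Γ) :
    ∃ a : ℕ → Γ, a 0 = 1 ∧ a (wl S g) = g ∧
      ∀ i j, i ≤ j → j ≤ wl S g → wl S ((a i)⁻¹ * a j) = j - i := by
  obtain ⟨l, hl, hl1, hl2⟩ := wl_spec hS g
  have key : ∀ i j, i ≤ j → j ≤ wl S g →
      wl S ((l.take i).prod⁻¹ * (l.take j).prod) ≤ j - i := by
    intro i j hij hj
    have h1 : l.take j = l.take i ++ (l.take j).drop i := by
      conv_lhs => rw [← List.take_append_drop i (l.take j)]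
      rw [List.take_take, min_eq_left hij]
    rw [h1, List.prod_append, inv_mul_cancel_left]
    refine (wl_le (S := S) _ fun x hx => hl1 x ?_).trans ?_
    · exact List.mem_of_mem_take (List.mem_of_mem_drop hx)
    · rw [List.length_drop, List.length_take]; omega
  refine ⟨fun i => (l.take i).prod, by simp, ?_, ?_⟩
  · show (l.take (wl S g)).prod = g
    rw [← hl, List.take_length, hl2]
  · intro i j hij hj
    refine le_antisymm (key i j hij hj) ?_
    have h0 := key 0 i (Nat.zero_le _) (hij.trans hj)
    have h1 := key j (wl S g) hj le_rfl
    rw [← hl, List.take_length, hl2, hl] at h1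
    simp only [List.take_zero, List.prod_nil, inv_one, one_mul] at h0
    have h2 := wl_tri hS 1 (l.take i).prod (l.take j).prod
    have h3 := wl_tri hS 1 (l.take j).prod g
    simp only [inv_one, one_mul] at h2 h3
    simp only
    omega

/-! Geometry of nonelementary hyperbolic groups -/

theorem nonelem_infinite (hne : Nonelementary Γ) : Infinite Γ := by
  have h := hne 1
  rw [Subgroup.zpowers_one_eq_bot, Subgroup.index_bot] at h
  by_contra hf
  rw [not_infinite_iff_finite] at hf
  exact (Nat.card_pos (α := Γ)).ne' h

/-- Arbitrarily long geodesics. -/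
theorem exists_geod {S : Set Γ} (hS : IsGenSet S) (hne : Nonelementary Γ) (N : ℕ) :
    ∃ a : ℕ → Γ, ∀ i j, i ≤ j → j ≤ N → wl S ((a i)⁻¹ * a j) = j - i := by
  have := nonelem_infinite hne
  obtain ⟨g, hg⟩ := (ball_finite hS N).exists_notMem
  simp only [Set.mem_ofPred_eq, not_le] at hg
  obtain ⟨a, -, -, ha⟩ := exists_geod_of hS g
  exact ⟨a, fun i j hij hj => ha i j hij (by omega)⟩

/-- Existence of an element of infinite order. -/
theorem exists_infinite_order {S : Set Γ} {δ : ℝ} (hS : IsGenSet S) (hδ : IsHyperbolic S δ)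
    (hne : Nonelementary Γ) : ∃ u : Γ, ∀ n : ℕ, 0 < n → u ^ n ≠ 1 := by
  obtain ⟨r, hr⟩ := exists_nat_gt (4 * δ + 1)
  have hδ0 := hδ.1
  have hr1 : 0 < r := by
    have : (0 : ℝ) < r := by linarith
    exact_mod_cast this
  set B := (ballF hS r).card with hB
  obtain ⟨a, ha⟩ := exists_geod hS hne (r * (B + 2))
  have hmaps : ∀ k ∈ Finset.range (B + 1),
      (fun k => (a (r * k))⁻¹ * a (r * (k + 1))) k ∈ ballF hS r := by
    intro k hk
    rw [Finset.mem_range] at hk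
    rw [mem_ballF]
    simp only
    rw [ha _ _ (Nat.mul_le_mul_left _ (by omega)) (Nat.mul_le_mul_left _ (by omega))]
    rw [← Nat.mul_sub]; simp
  obtain ⟨k, hk, l, hl, hkl, he⟩ := Finset.exists_ne_map_eq_of_card_lt_of_maps_to
    (by simp [hB]) hmaps
  wlog hlt : k < l generalizing k l
  · exact this l hl k hk hkl.symm he.symm (by omega)
  rw [Finset.mem_range] at hk hl
  set u := (a (r * k))⁻¹ * a (r * l) with hu
  set q := (a (r * k))⁻¹ * a (r * (k + 1)) with hq
  have e1 : r * (k + 1) = r * k + r := by ring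
  have e2 : r * (l + 1) = r * l + r := by ring
  have e3 : r * (k + 1) ≤ r * l := Nat.mul_le_mul_left _ (by omega)
  have e4 : r * (l + 1) ≤ r * (B + 2) := Nat.mul_le_mul_left _ (by omega)
  have hul : wl S u = r * l - r * k := ha _ _ (by omega) (by omega)
  have hql : wl S q = r := by
    rw [hq, ha _ _ (by omega) (by omega)]; omega
  have huq : wl S (u * q) = r * l - r * k + r := by
    rw [he, hu, mul_assoc, mul_inv_cancel_left, ha _ _ (by omega) (by omega)]; omega
  have hiq : wl S (u⁻¹ * q) = r * l - r * k - r := by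
    have : u⁻¹ * q = ((a (r * (k + 1)))⁻¹ * a (r * l))⁻¹ := by
      rw [hu, hq]; group
    rw [this, wl_inv hS, ha _ _ (by omega) (by omega)]; omega
  obtain ⟨m, hm⟩ : ∃ m, r * l = r * k + r + m := ⟨r * l - r * k - r, by omega⟩
  have hul' : (wl S u : ℝ) = r + m := by
    have : wl S u = r + m := by omega
    exact_mod_cast this
  have g1 : gp S 1 q u = r := by
    rw [gp_comm hS, gp_one hS, hql, hiq, hul']
    have : r * l - r * k - r = m := by omega
    rw [this]; ring
  have g2 : gp S 1 q u⁻¹ = 0 := by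
    rw [gp_comm hS, gp_one hS, wl_inv hS, inv_inv, huq, hql, hul']
    have : r * l - r * k + r = r + m + r := by omega
    rw [this]; push_cast; ring
  have g3 : gp S 1 u⁻¹ u ≤ δ := by
    have := hyp_le hδ (x := q) (y := u⁻¹) (z := u) (a := 0) g2.le (by rw [g1]; linarith)
    linarith
  have hm0 : (0 : ℝ) ≤ m := Nat.cast_nonneg m
  have main : ∀ n : ℕ, gp S 1 u⁻¹ (u ^ (n + 1)) ≤ 2 * δ := by
    intro n
    induction n with
    | zero => simp only [zero_add, pow_one]; linarith
    | succ n ih =>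
      have h1 : gp S 1 u (u ^ (n + 2)) = wl S u - gp S 1 u⁻¹ (u ^ (n + 1)) := by
        rw [← gp_shift hS, ← pow_succ']
      have := hyp_le hδ (x := u) (y := u⁻¹) (z := u ^ (n + 2)) (a := δ)
        (by rw [gp_comm hS]; exact g3) (by rw [h1, hul']; linarith)
      calc gp S 1 u⁻¹ (u ^ (n + 1 + 1)) ≤ δ + δ := this
        _ = 2 * δ := by ring
  refine ⟨u, fun n hn hun => ?_⟩
  obtain ⟨n, rfl⟩ : ∃ n', n = n' + 1 := ⟨n - 1, by omega⟩
  have h2 : gp S 1 u⁻¹ (u ^ n) = wl S u := by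
    have : u ^ n = u⁻¹ := by
      rw [pow_succ] at hun
      exact eq_inv_of_mul_eq_one_left hun
    rw [this, gp_one hS, wl_inv hS]
    simp [wl_one]
  cases n with
  | zero =>
    simp only [zero_add, pow_one] at hun
    rw [hun, wl_one] at hul'
    simp at hul'
    have : (0 : ℝ) < r := by exact_mod_cast hr1
    linarith
  | succ n =>
    have := main n
    rw [h2, hul'] at this
    linarith

/-- Linear growth is impossible. -/
theorem not_linear_growth {S : Set Γ} {δ : ℝ} (hS : IsGenSet S) (hδ : IsHyperbolic S δ)
    (hne : Nonelementary Γ) (K : ℕ) (h : ∀ n, (ballF hS n).card ≤ K * (n + 1)) : False := by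
  classical
  obtain ⟨u, hu⟩ := exists_infinite_order hS hδ hne
  have hinf : Infinite (Γ ⧸ Subgroup.zpowers u) := by
    have := hne u
    rw [Subgroup.index, Nat.card_eq_zero] at this
    rcases this with h | h
    · exact (h.false (QuotientGroup.mk 1)).elim
    · exact h
  obtain ⟨Q, hQ⟩ := Infinite.exists_subset_card_eq (Γ ⧸ Subgroup.zpowers u) (K * wl S u + 1)
  set M := Q.sup fun q => wl S (Quotient.out q) with hM
  set n := K * (M + 1) + 1 with hn
  have hpow : ∀ j : ℕ, wl S (u ^ j) ≤ j * wl S u := by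
    intro j
    induction j with
    | zero => simp [wl_one]
    | succ j ih =>
      rw [pow_succ]
      have := wl_mul hS (u ^ j) u
      linarith [this, ih]
  have hcard : (Q ×ˢ Finset.range n).card ≤ (ballF hS (M + n * wl S u)).card := by
    refine Finset.card_le_card_of_injOn (fun p => Quotient.out p.1 * u ^ p.2) ?_ ?_
    · rintro ⟨q, j⟩ hp
      simp only [Finset.coe_product, Set.mem_prod, Finset.mem_coe, Finset.mem_range] at hp
      rw [Finset.mem_coe, mem_ballF]
      have h1 := wl_mul hS (Quotient.out q) (u ^ j)
      have h2 : wl S (Quotient.out q) ≤ M :=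
        Finset.le_sup (f := fun q => wl S (Quotient.out q)) hp.1
      have h3 : j * wl S u ≤ n * wl S u := Nat.mul_le_mul_right _ hp.2.le
      have h4 := hpow j
      simp only
      omega
    · rintro ⟨q, j⟩ hp ⟨q', j'⟩ hp' he
      simp only at he
      have hqq : q = q' := by
        rw [← Quotient.out_eq q, ← Quotient.out_eq q']
        refine QuotientGroup.eq.2 ?_
        have : (Quotient.out q)⁻¹ * Quotient.out q' = u ^ j * (u ^ j')⁻¹ := by
          rw [eq_mul_inv_iff_mul_eq, mul_assoc, ← he, inv_mul_cancel_left]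
        rw [this]
        exact Subgroup.mul_mem _ (Subgroup.pow_mem _ (Subgroup.mem_zpowers u) _)
          (Subgroup.inv_mem _ (Subgroup.pow_mem _ (Subgroup.mem_zpowers u) _))
      subst hqq
      have hp2 : u ^ j = u ^ j' := mul_left_cancel he
      have hno : ¬ IsOfFinOrder u := by
        rw [isOfFinOrder_iff_pow_eq_one]
        rintro ⟨m, hm, hm'⟩
        exact hu m hm hm'
      have := (injective_pow_iff_not_isOfFinOrder.2 hno) hp2
      simp [this]
  rw [Finset.card_product, hQ, Finset.card_range] at hcard
  have := hcard.trans (h _)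
  have e : K * (M + n * wl S u + 1) = K * wl S u * n + K * (M + 1) := by ring
  rw [e] at this
  have e2 : (K * wl S u + 1) * n = K * wl S u * n + n := by ring
  rw [e2] at this
  omega

/-- Three separated directions. -/
theorem three_directions {S : Set Γ} {δ : ℝ} (hS : IsGenSet S) (hδ : IsHyperbolic S δ)
    (hne : Nonelementary Γ) (D : ℕ) : ∃ t : Fin 3 → Γ, (∀ i, D ≤ wl S (t i)) ∧
      ∀ i j, i ≠ j → gp S 1 (t i) (t j) ≤ 2 * δ + 1 := by
  classical
  by_contra hcon
  have hδ0 := hδ.1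
  have hthree : ∀ p q r : Γ, D ≤ wl S p → D ≤ wl S q → D ≤ wl S r →
      gp S 1 p q ≤ 2 * δ + 1 → gp S 1 p r ≤ 2 * δ + 1 → gp S 1 q r ≤ 2 * δ + 1 → False := by
    intro p q r hp hq hr h1 h2 h3
    refine hcon ⟨![p, q, r], ?_, ?_⟩
    · intro i; fin_cases i <;> simpa
    · intro i j hij
      fin_cases i <;> fin_cases j <;> first
        | exact absurd rfl hij
        | assumption
        | (rw [gp_comm hS]; assumption)
  refine not_linear_growth hS hδ hne ((4 + 2 * D + 1) * (ballF hS D).card) fun n => ?_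
  set N := 2 * n + D with hN
  obtain ⟨a, ha⟩ := exists_geod hS hne (2 * N)
  have ha' : ∀ i j, i ≤ 2 * N → j ≤ 2 * N → wl S ((a i)⁻¹ * a j) = (j - i) + (i - j) := by
    intro i j hi hj
    rcases le_total i j with h | h
    · rw [ha i j h hj]; omega
    · rw [wl_inv_mul_comm hS, ha j i h hi]; omega
  -- projection lemma
  have proj : ∀ g i k, i ≤ 2 * N → k ≤ 2 * N →
      (∀ j ≤ 2 * N, wl S ((a i)⁻¹ * g) ≤ wl S ((a j)⁻¹ * g)) → (k = 0 ∨ k = 2 * N) →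
      gp S 1 ((a i)⁻¹ * g) ((a i)⁻¹ * a k) ≤ 2 * δ + 1 := by
    intro g i k hi hk hmin hk0
    by_contra hc
    push Not at hc
    set κ := gp S 1 ((a i)⁻¹ * g) ((a i)⁻¹ * a k) with hκ
    have hκ0 : 0 ≤ κ := gp_nonneg hS _ _
    set j := ⌊κ⌋₊ with hj
    have hjκ : (j : ℝ) ≤ κ := Nat.floor_le hκ0
    have hκj : κ < j + 1 := Nat.lt_floor_add_one κ
    have hkle : κ ≤ wl S ((a i)⁻¹ * a k) := gp_le_right hS _ _
    have hjle : j ≤ wl S ((a i)⁻¹ * a k) := by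
      have : (j : ℝ) ≤ (wl S ((a i)⁻¹ * a k) : ℝ) := hjκ.trans hkle
      exact_mod_cast this
    rw [ha' i k hi hk] at hjle
    obtain ⟨l, hl, hl1, hl2⟩ : ∃ l ≤ 2 * N, wl S ((a i)⁻¹ * a l) = j ∧
        wl S ((a l)⁻¹ * a k) + j = wl S ((a i)⁻¹ * a k) := by
      rcases hk0 with h | h
      · refine ⟨i - j, by omega, ?_, ?_⟩
        · rw [ha' _ _ hi (by omega)]; omega
        · rw [ha' _ _ (by omega) hk, ha' _ _ hi hk]; omega
      · refine ⟨i + j, by omega, ?_, ?_⟩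
        · rw [ha' _ _ hi (by omega)]; omega
        · rw [ha' _ _ (by omega) hk, ha' _ _ hi hk]; omega
    have hg1 : gp S 1 ((a i)⁻¹ * a l) ((a i)⁻¹ * a k) = j := by
      rw [gp_one hS, hl1]
      have : ((a i)⁻¹ * a l)⁻¹ * ((a i)⁻¹ * a k) = (a l)⁻¹ * a k := by group
      rw [this, ← hl2]; push_cast; ring
    have hg2 := hδ.2 ((a i)⁻¹ * g) ((a i)⁻¹ * a l) ((a i)⁻¹ * a k)
    rw [hg1, ← hκ, min_eq_right hjκ, gp_one hS, hl1] at hg2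
    have e : ((a i)⁻¹ * g)⁻¹ * ((a i)⁻¹ * a l) = g⁻¹ * a l := by group
    rw [e, wl_inv_mul_comm hS g] at hg2
    have h3 : (wl S ((a i)⁻¹ * g) : ℝ) ≤ wl S ((a l)⁻¹ * g) := by exact_mod_cast hmin l hl
    linarith
  have cover : ballF hS n ⊆ (Finset.range (2 * N + 1)).biUnion fun i =>
      (ballF hS D).image fun b => (a N)⁻¹ * a i * b := by
    intro g0 hg0
    rw [mem_ballF] at hg0
    set g := a N * g0 with hg
    obtain ⟨i, hi, hmin⟩ := Finset.exists_min_image (Finset.range (2 * N + 1))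
      (fun i => wl S ((a i)⁻¹ * g)) ⟨0, by simp⟩
    rw [Finset.mem_range] at hi
    have hmin' : ∀ j ≤ 2 * N, wl S ((a i)⁻¹ * g) ≤ wl S ((a j)⁻¹ * g) :=
      fun j hj => hmin j (by rw [Finset.mem_range]; omega)
    have hi' : i ≤ 2 * N := by omega
    have hN1 := hmin' N (by omega)
    have hN2 : (a N)⁻¹ * g = g0 := by rw [hg, inv_mul_cancel_left]
    rw [hN2] at hN1
    have h4 := wl_tri hS (a i) g (a N)
    rw [wl_inv_mul_comm hS g, hN2, ha' i N hi' (by omega)] at h4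
    have hlt : wl S ((a i)⁻¹ * g) < D := by
      by_contra hge
      push Not at hge
      refine hthree ((a i)⁻¹ * g) ((a i)⁻¹ * a 0) ((a i)⁻¹ * a (2 * N)) hge ?_ ?_
        (proj g i 0 hi' (by omega) hmin' (Or.inl rfl))
        (proj g i (2 * N) hi' le_rfl hmin' (Or.inr rfl)) ?_
      · rw [ha' _ _ hi' (by omega)]; omega
      · rw [ha' _ _ hi' le_rfl]; omega
      · rw [gp_one hS]
        have e : ((a i)⁻¹ * a 0)⁻¹ * ((a i)⁻¹ * a (2 * N)) = (a 0)⁻¹ * a (2 * N) := by group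
        rw [e, ha' _ _ hi' (by omega), ha' _ _ hi' le_rfl, ha' _ _ (by omega) le_rfl]
        have : (2 * N - 0 + (0 - 2 * N)) = (0 - i + (i - 0)) + (2 * N - i + (i - 2 * N)) := by
          omega
        rw [this]; push_cast; linarith
    refine Finset.mem_biUnion.2 ⟨i, by rw [Finset.mem_range]; omega, ?_⟩
    refine Finset.mem_image.2 ⟨(a i)⁻¹ * g, by rw [mem_ballF]; exact hlt.le, ?_⟩
    rw [← hN2]; group
  calc (ballF hS n).card ≤ _ := Finset.card_le_card cover
    _ ≤ (Finset.range (2 * N + 1)).card * (ballF hS D).card :=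
        Finset.card_biUnion_le_card_mul _ _ _ fun i _ => Finset.card_image_le
    _ ≤ (4 + 2 * D + 1) * (ballF hS D).card * (n + 1) := by
        rw [Finset.card_range, mul_right_comm]
        refine Nat.mul_le_mul_right _ ?_
        rw [hN]; nlinarith [Nat.zero_le (n * D)]

/-- Exponentially many elements avoiding any given direction. -/
theorem tree_count {S : Set Γ} {δ : ℝ} (hS : IsGenSet S) (hδ : IsHyperbolic S δ)
    (hne : Nonelementary Γ) : ∃ L : ℕ, ∀ n : ℕ, ∀ p : Γ, ∃ W : Finset Γ, 2 ^ n ≤ W.card ∧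
      ∀ w ∈ W, wl S w ≤ n * L ∧ gp S 1 p w ≤ 4 * δ + 1 := by
  classical
  have hδ0 := hδ.1
  obtain ⟨D, hD⟩ := exists_nat_gt (9 * δ + 2)
  obtain ⟨t, htD, htt⟩ := three_directions hS hδ hne D
  refine ⟨Finset.univ.sup fun i => wl S (t i), fun n => ?_⟩
  have htL : ∀ i, wl S (t i) ≤ Finset.univ.sup fun i => wl S (t i) := fun i =>
    Finset.le_sup (f := fun i => wl S (t i)) (Finset.mem_univ i)
  set L := Finset.univ.sup fun i => wl S (t i) with hL
  have htD' : ∀ i, 9 * δ + 2 < wl S (t i) := fun i => by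
    have : (D : ℝ) ≤ wl S (t i) := by exact_mod_cast htD i
    linarith
  have two : ∀ p : Γ, ∃ i j : Fin 3, i ≠ j ∧ gp S 1 p (t i) ≤ 3 * δ + 1 ∧
      gp S 1 p (t j) ≤ 3 * δ + 1 := by
    intro p
    have h : ∀ i j, i ≠ j → gp S 1 p (t i) ≤ 3 * δ + 1 ∨ gp S 1 p (t j) ≤ 3 * δ + 1 := by
      intro i j hij
      by_cases h1 : gp S 1 p (t i) ≤ 3 * δ + 1
      · exact Or.inl h1
      · right
        have := hyp_le hδ (x := t i) (y := t j) (z := p) (a := 2 * δ + 1) (htt i j hij)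
          (by rw [gp_comm hS]; linarith)
        rw [gp_comm hS]; linarith
    by_cases h0 : gp S 1 p (t 0) ≤ 3 * δ + 1
    · rcases h 1 2 (by decide) with h1 | h2
      · exact ⟨0, 1, by decide, h0, h1⟩
      · exact ⟨0, 2, by decide, h0, h2⟩
    · exact ⟨1, 2, by decide, (h 0 1 (by decide)).resolve_left h0,
        (h 0 2 (by decide)).resolve_left h0⟩
  induction n with
  | zero =>
    intro p
    refine ⟨{1}, by simp, ?_⟩
    intro w hw
    rw [Finset.mem_singleton] at hw
    subst hw
    have := gp_le_right hS p 1
    rw [wl_one] at this ⊢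
    refine ⟨by simp, ?_⟩
    push_cast at this
    linarith
  | succ n ih =>
    intro p
    obtain ⟨i, j, hij, hi, hj⟩ := two p
    choose W hW1 hW2 using ih
    have deep : ∀ i, ∀ w ∈ W (t i)⁻¹, 5 * δ + 1 < gp S 1 (t i) (t i * w) := by
      intro i w hw
      rw [gp_shift hS]
      have := (hW2 _ w hw).2
      linarith [htD' i]
    refine ⟨((W (t i)⁻¹).image fun w => t i * w) ∪ ((W (t j)⁻¹).image fun w => t j * w), ?_, ?_⟩
    · rw [Finset.card_union_of_disjoint, Finset.card_image_of_injective _ (mul_right_injective _),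
        Finset.card_image_of_injective _ (mul_right_injective _), pow_succ]
      · have h1 := hW1 (t i)⁻¹
        have h2 := hW1 (t j)⁻¹
        omega
      · rw [Finset.disjoint_left]
        intro g hg hg'
        obtain ⟨w, hw, rfl⟩ := Finset.mem_image.1 hg
        obtain ⟨w', hw', he⟩ := Finset.mem_image.1 hg'
        have d1 := deep i w hw
        have d2 := deep j w' hw'
        rw [he] at d2
        have := hyp_le hδ (x := t i) (y := t j) (z := t i * w) (a := 2 * δ + 1) (htt i j hij)
          (by linarith)
        linarith
    · have key : ∀ i, gp S 1 p (t i) ≤ 3 * δ + 1 → ∀ w ∈ W (t i)⁻¹,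
          wl S (t i * w) ≤ (n + 1) * L ∧ gp S 1 p (t i * w) ≤ 4 * δ + 1 := by
        intro i hi w hw
        constructor
        · have h1 := wl_mul hS (t i) w
          have h2 := (hW2 _ w hw).1
          have h3 := htL i
          rw [add_mul, one_mul]; omega
        · have := hyp_le hδ (x := t i) (y := p) (z := t i * w) (a := 3 * δ + 1)
            (by rw [gp_comm hS]; exact hi) (by linarith [deep i w hw])
          linarith
      intro g hg
      rcases Finset.mem_union.1 hg with h | h
      · obtain ⟨w, hw, rfl⟩ := Finset.mem_image.1 h
        exact key i hi w hw
      · obtain ⟨w, hw, rfl⟩ := Finset.mem_image.1 h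
        exact key j hj w hw

/-- Ponzi scheme, every point has at least `2R` children, at most `R` parents. -/
theorem paradox {S : Set Γ} {δ : ℝ} (hS : IsGenSet S) (hδ : IsHyperbolic S δ)
    (hne : Nonelementary Γ) : ∃ (F : Finset Γ) (R : ℕ) (W : Γ → Finset Γ), 0 < R ∧
      (∀ h, W h ⊆ F) ∧ (∀ h, 2 * R ≤ (W h).card) ∧
      ∀ y, ∀ E : Finset Γ, (∀ w ∈ E, w ∈ W (y * w⁻¹)) → E.card ≤ R := by
  classical
  have hδ0 := hδ.1
  obtain ⟨L, hL⟩ := tree_count hS hδ hne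
  obtain ⟨r, hr⟩ := exists_nat_gt (10 * δ + 2)
  set B := (ballF hS r).card with hB
  have hBpos : 0 < B := Finset.card_pos.2 ⟨1, by rw [mem_ballF, wl_one]; omega⟩
  obtain ⟨n, hn⟩ : ∃ n : ℕ, 2 * ((n * L + 1) * B) ≤ 2 ^ n := by
    have h1 : Tendsto (fun n : ℕ => (n : ℝ) ^ 1 / (2 : ℝ) ^ n) atTop (𝓝 0) :=
      tendsto_pow_const_div_const_pow_of_one_lt 1 (by norm_num)
    have hc : (0 : ℝ) < 1 / (2 * (L + 1) * B) := by positivity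
    obtain ⟨n, hn, hn1⟩ := ((h1.eventually (gt_mem_nhds hc)).and (eventually_ge_atTop 1)).exists
    refine ⟨n, ?_⟩
    rw [pow_one, div_lt_div_iff₀ (by positivity) (by positivity), one_mul] at hn
    have hn' : n * (2 * (L + 1) * B) < 2 ^ n := by exact_mod_cast hn
    refine le_trans ?_ hn'.le
    nlinarith [Nat.mul_le_mul_right B hn1]
  choose W hW1 hW2 using hL n
  refine ⟨ballF hS (n * L), (n * L + 1) * B, fun h => W h⁻¹, by positivity, ?_, ?_, ?_⟩
  · intro h w hw
    rw [mem_ballF]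
    exact (hW2 _ w hw).1
  · exact fun h => hn.trans (hW1 _)
  · intro y E hE
    have hE' : ∀ w ∈ E, wl S w ≤ n * L ∧ (wl S w : ℝ) - (4 * δ + 1) ≤ gp S 1 y⁻¹ w⁻¹ := by
      intro w hw
      have h := hW2 _ w (hE w hw)
      refine ⟨h.1, ?_⟩
      have h2 := h.2
      rw [gp_one hS] at h2 ⊢
      simp only [mul_inv_rev, inv_inv, inv_mul_cancel_right, wl_inv hS] at h2 ⊢
      have : wl S (w * y⁻¹) = wl S (y * w⁻¹) := by rw [← wl_inv hS]; simp
      rw [this] at h2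
      linarith
    have hfib : ∀ k, (E.filter fun w => wl S w = k).card ≤ B := by
      intro k
      rcases (E.filter fun w => wl S w = k).eq_empty_or_nonempty with h | ⟨w₀, hw₀⟩
      · rw [h]; simp
      · rw [Finset.mem_filter] at hw₀
        refine Finset.card_le_card_of_injOn (fun w => w₀ * w⁻¹) ?_ ?_
        · intro w hw
          rw [Finset.mem_coe, Finset.mem_filter] at hw
          rw [Finset.mem_coe, mem_ballF]
          have h1 := (hE' w hw.1).2
          have h2 := (hE' w₀ hw₀.1).2
          have h3 := hδ.2 w₀⁻¹ w⁻¹ y⁻¹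
          rw [gp_comm hS y⁻¹] at h1 h2
          rw [hw.2] at h1
          rw [hw₀.2] at h2
          have h4 := le_min h2 h1
          have h5 : (k : ℝ) - (4 * δ + 1) - δ ≤ gp S 1 w₀⁻¹ w⁻¹ := by linarith
          rw [gp_one hS, wl_inv hS, wl_inv hS, hw.2, hw₀.2, inv_inv] at h5
          have : (wl S (w₀ * w⁻¹) : ℝ) < r := by linarith
          have h6 : wl S (w₀ * w⁻¹) < r := by exact_mod_cast this
          exact h6.le
        · intro w _ w' _ he
          simpa using he
    have := Finset.card_le_mul_card_image_of_maps_to (s := E) (t := Finset.range (n * L + 1))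
      (f := fun w => wl S w)
      (fun w hw => by rw [Finset.mem_range]; have := (hE' w hw).1; omega) B
      (fun k _ => hfib k)
    rw [Finset.card_range] at this
    linarith [mul_comm B (n * L + 1)]

theorem paradox_sum (F : Finset Γ) (R : ℕ) (W : Γ → Finset Γ)
    (hWF : ∀ h, W h ⊆ F) (hWc : ∀ h, 2 * R ≤ (W h).card)
    (hE : ∀ y, ∀ E : Finset Γ, (∀ w ∈ E, w ∈ W (y * w⁻¹)) → E.card ≤ R)
    (φ : Γ → ℝ) (h0 : ∀ h, 0 ≤ φ h) (hs : Summable φ) :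
    (R : ℝ) * ∑' h, φ h ≤ ∑ w ∈ F, ∑' h, |φ h - φ (h * w)| := by
  classical
  have hsw : ∀ w : Γ, Summable (fun h => φ (h * w)) := fun w =>
    (Equiv.mulRight w).summable_iff.mpr hs
  have hsA : ∀ w : Γ, Summable (fun h => if w ∈ W h then φ h else 0) := fun w =>
    Summable.of_nonneg_of_le (fun h => by split_ifs <;> simp [h0])
      (fun h => by split_ifs <;> simp [h0]) hs
  have hsB : ∀ w : Γ, Summable (fun h => if w ∈ W h then φ (h * w) else 0) := fun w =>
    Summable.of_nonneg_of_le (fun h => by split_ifs <;> simp [h0])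
      (fun h => by split_ifs <;> simp [h0]) (hsw w)
  have hsC : ∀ w : Γ, Summable (fun y => if w ∈ W (y * w⁻¹) then φ y else 0) := fun w =>
    Summable.of_nonneg_of_le (fun h => by split_ifs <;> simp [h0])
      (fun h => by split_ifs <;> simp [h0]) hs
  have hsD : ∀ w : Γ, Summable (fun h => |φ h - φ (h * w)|) := fun w => (hs.sub (hsw w)).abs
  have h1 : 2 * (R : ℝ) * ∑' h, φ h ≤ ∑ w ∈ F, ∑' h, (if w ∈ W h then φ h else 0) := by
    rw [← Summable.tsum_finsetSum (fun w _ => hsA w), ← tsum_mul_left]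
    refine Summable.tsum_le_tsum (fun h => ?_) (hs.mul_left _) (summable_sum fun w _ => hsA w)
    rw [← Finset.sum_filter, Finset.sum_const, nsmul_eq_mul]
    refine mul_le_mul_of_nonneg_right ?_ (h0 h)
    have : W h ⊆ F.filter (fun w => w ∈ W h) := fun w hw => by simp [hw, hWF h hw]
    exact_mod_cast (hWc h).trans (Finset.card_le_card this)
  have h2 : ∑ w ∈ F, ∑' h, (if w ∈ W h then φ (h * w) else 0) ≤ (R : ℝ) * ∑' h, φ h := by
    have e : ∀ w : Γ, ∑' h, (if w ∈ W h then φ (h * w) else 0)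
        = ∑' y, (if w ∈ W (y * w⁻¹) then φ y else 0) := fun w => by
      rw [← (Equiv.mulRight w).tsum_eq (fun y => if w ∈ W (y * w⁻¹) then φ y else 0)]
      simp
    simp_rw [e]
    rw [← Summable.tsum_finsetSum (fun w _ => hsC w), ← tsum_mul_left]
    refine Summable.tsum_le_tsum (fun h => ?_) (summable_sum fun w _ => hsC w) (hs.mul_left _)
    rw [← Finset.sum_filter, Finset.sum_const, nsmul_eq_mul]
    refine mul_le_mul_of_nonneg_right ?_ (h0 h)
    exact_mod_cast hE h _ (fun w hw => (Finset.mem_filter.mp hw).2)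
  have h3 : ∑ w ∈ F, ∑' h, (if w ∈ W h then φ h else 0) ≤
      ∑ w ∈ F, ∑' h, (if w ∈ W h then φ (h * w) else 0) + ∑ w ∈ F, ∑' h, |φ h - φ (h * w)| := by
    rw [← Finset.sum_add_distrib]
    refine Finset.sum_le_sum fun w _ => ?_
    rw [← (hsB w).tsum_add (hsD w)]
    refine Summable.tsum_le_tsum (fun h => ?_) (hsA w) ((hsB w).add (hsD w))
    split_ifs
    · linarith [le_abs_self (φ h - φ (h * w))]
    · simp
  linarith

/-- The Hilbert space. -/
abbrev HH (Γ : Type) := lp (fun _ : Γ => ℝ) 2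

theorem HH_summable (ξ : HH Γ) : Summable (fun h => (ξ h) ^ 2) := by
  have := (lp.hasSum_norm (p := 2) (by norm_num) ξ).summable
  simpa using this

theorem HH_norm (ξ : HH Γ) : ‖ξ‖ ^ 2 = ∑' h, (ξ h) ^ 2 := by
  have := (lp.hasSum_norm (p := 2) (by norm_num) ξ).tsum_eq
  simpa using this.symm

theorem HH_mem (f : Γ → ℝ) (h : Summable (fun h => (f h) ^ 2)) : Memℓp f 2 := by
  rw [memℓp_gen_iff (by norm_num)]
  simpa using h

/-- right translation -/
noncomputable def Rt (g : Γ) : HH Γ →ₗᵢ[ℝ] HH Γ where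
  toFun ξ := ⟨fun x => ξ (x * g), HH_mem _ ((Equiv.mulRight g).summable_iff.mpr (HH_summable ξ))⟩
  map_add' ξ η := by ext x; simp; rfl
  map_smul' c ξ := by ext x; simp
  norm_map' ξ := by
    rw [← sq_eq_sq₀ (norm_nonneg _) (norm_nonneg _), HH_norm, HH_norm]
    exact (Equiv.mulRight g).tsum_eq (fun x => (ξ x)^2)

@[simp] theorem Rt_apply (g : Γ) (ξ : HH Γ) (x : Γ) : (Rt g ξ) x = ξ (x * g) := rfl

theorem spectral_gap {S : Set Γ} {δ : ℝ} (hS : IsGenSet S) (hδ : IsHyperbolic S δ)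
    (hne : Nonelementary Γ) : ∃ F : Finset Γ, ∃ ε : ℝ, 0 < ε ∧ ε ≤ 1 ∧ ∀ ξ : HH Γ, ∃ w ∈ F,
      ε * ‖ξ‖ ≤ ‖ξ - Rt w ξ‖ := by
  obtain ⟨F, R, W, hR, hWF, hWc, hE⟩ := paradox hS hδ hne
  have hF : F.Nonempty := by
    have h1 := hWc 1
    have h2 := Finset.card_le_card (hWF 1)
    exact Finset.card_pos.mp (by omega)
  have hc : (0:ℝ) < F.card := by exact_mod_cast hF.card_pos
  have hR' : (0:ℝ) < R := by exact_mod_cast hR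
  refine ⟨F, min 1 (R / (2 * F.card)), by positivity, min_le_left _ _, fun ξ => ?_⟩
  by_contra hcon
  push Not at hcon
  have h1 := paradox_sum F R W hWF hWc hE (fun h => ξ h ^ 2) (fun h => sq_nonneg _) (HH_summable ξ)
  rw [← HH_norm] at h1
  have h2 : ∀ w ∈ F, ∑' h, |ξ h ^ 2 - ξ (h * w) ^ 2| ≤ ‖ξ - Rt w ξ‖ * (2 * ‖ξ‖) := fun w _ => by
    have := (lp.tsum_mul_le_mul_norm (p := 2) (q := 2) (by norm_num; exact Real.HolderConjugate.two_two) (ξ - Rt w ξ) (ξ + Rt w ξ)).2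
    have e : ∀ h, |ξ h ^ 2 - ξ (h * w) ^ 2| = ‖(ξ - Rt w ξ) h‖ * ‖(ξ + Rt w ξ) h‖ := fun h => by
      simp only [lp.coeFn_sub, lp.coeFn_add, Pi.sub_apply, Pi.add_apply, Rt_apply, Real.norm_eq_abs, ← abs_mul]
      ring_nf
    simp_rw [e]
    refine this.trans (mul_le_mul_of_nonneg_left ?_ (norm_nonneg _))
    refine (norm_add_le _ _).trans ?_
    rw [(Rt w).norm_map]; linarith
  have h3 : ∑ w ∈ F, ∑' h, |ξ h ^ 2 - ξ (h * w) ^ 2| ≤ ∑ w ∈ F, ‖ξ - Rt w ξ‖ * (2 * ‖ξ‖) :=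
    Finset.sum_le_sum h2
  obtain ⟨w0, hw0⟩ := hF
  have hξ : 0 < ‖ξ‖ := by
    by_contra h
    have h0 : ‖ξ‖ = 0 := le_antisymm (not_lt.mp h) (norm_nonneg _)
    have := hcon w0 hw0
    rw [h0] at this
    simp at this
    exact absurd this (not_lt.mpr (norm_nonneg _))
  have h4 : ∑ w ∈ F, ‖ξ - Rt w ξ‖ * (2 * ‖ξ‖) < ∑ w ∈ F, (R / (2 * F.card) * ‖ξ‖) * (2 * ‖ξ‖) := by
    refine Finset.sum_lt_sum_of_nonempty ⟨w0, hw0⟩ fun w hw => ?_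
    refine mul_lt_mul_of_pos_right ((hcon w hw).trans_le ?_) (by positivity)
    exact mul_le_mul_of_nonneg_right (min_le_right _ _) (norm_nonneg _)
  rw [Finset.sum_const, nsmul_eq_mul] at h4
  have : (F.card : ℝ) * ((R / (2 * F.card) * ‖ξ‖) * (2 * ‖ξ‖)) = R * ‖ξ‖ ^ 2 := by
    field_simp
  linarith

/-- right translation as a continuous operator -/
noncomputable def Tt (g : Γ) : HH Γ →L[ℝ] HH Γ := (Rt g).toContinuousLinearMap

theorem Tt_apply (g : Γ) (ξ : HH Γ) : Tt g ξ = Rt g ξ := rfl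

theorem Tt_one : Tt (1 : Γ) = 1 := by
  ext ξ x
  simp [Tt_apply]

theorem Tt_mul (g h : Γ) : Tt (g * h) = Tt g * Tt h := by
  ext ξ x
  simp [Tt_apply, mul_assoc]

theorem Tt_norm (g : Γ) : ‖Tt g‖ ≤ 1 := (Rt g).norm_toContinuousLinearMap_le

/-- Markov operator -/
noncomputable def Pop {S : Set Γ} (hS : IsGenSet S) (μ : Γ → ℝ) : HH Γ →L[ℝ] HH Γ :=
  ∑ g ∈ hS.1.toFinset, μ g • Tt g

theorem mu_sum {S : Set Γ} (hS : IsGenSet S) {μ : Γ → ℝ} (hμ : IsRWMeasure S μ) :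
    ∑ g ∈ hS.1.toFinset, μ g = 1 := by
  rw [← hμ.total]
  refine (tsum_eq_sum fun g hg => ?_).symm
  by_contra h
  exact hg (by simpa using hμ.support_subset g h)

theorem sum_Tt_norm {μ : Γ → ℝ} (h0 : ∀ g, 0 ≤ μ g) (A : Finset Γ) :
    ‖∑ g ∈ A, μ g • Tt g‖ ≤ ∑ g ∈ A, μ g := by
  refine norm_sum_le_of_le _ fun g _ => ?_
  rw [norm_smul, Real.norm_of_nonneg (h0 g)]
  exact mul_le_of_le_one_right (h0 g) (Tt_norm g)

theorem Pop_norm {S : Set Γ} (hS : IsGenSet S) {μ : Γ → ℝ} (hμ : IsRWMeasure S μ) :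
    ‖Pop hS μ‖ ≤ 1 := (sum_Tt_norm hμ.nonneg _).trans (mu_sum hS hμ).le

theorem Pop_list {S : Set Γ} (hS : IsGenSet S) {μ : Γ → ℝ} (hμ : IsRWMeasure S μ)
    (l : List Γ) (hl : ∀ x ∈ l, 0 < μ x) : ∃ c : ℝ, 0 < c ∧ c ≤ 1 ∧ ∃ E : HH Γ →L[ℝ] HH Γ,
      ‖E‖ ≤ 1 - c ∧ (Pop hS μ) ^ l.length = c • Tt l.prod + E := by
  classical
  induction l with
  | nil => exact ⟨1, one_pos, le_rfl, 0, by simp, by simp [Tt_one]⟩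
  | cons a l ih =>
    obtain ⟨c, hc, hc1, E, hE, heq⟩ := ih (fun x hx => hl x (by simp [hx]))
    have ha : 0 < μ a := hl a (by simp)
    have haS : a ∈ hS.1.toFinset := by simpa using hμ.support_subset a ha.ne'
    have hs := mu_sum hS hμ
    rw [← Finset.add_sum_erase _ _ haS] at hs
    set Ea := ∑ g ∈ hS.1.toFinset.erase a, μ g • Tt g with hEa
    have hPa : Pop hS μ = μ a • Tt a + Ea := by
      rw [Pop, ← Finset.add_sum_erase _ _ haS]
    have hEan : ‖Ea‖ ≤ 1 - μ a := by
      refine (sum_Tt_norm hμ.nonneg _).trans ?_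
      linarith
    have ha1 : μ a ≤ 1 := by linarith [norm_nonneg Ea]
    refine ⟨μ a * c, by positivity, by nlinarith, c • (Ea * Tt l.prod) + Pop hS μ * E, ?_, ?_⟩
    · refine (norm_add_le _ _).trans ?_
      have h1 : ‖c • (Ea * Tt l.prod)‖ ≤ c * (1 - μ a) := by
        rw [norm_smul, Real.norm_of_nonneg hc.le]
        refine mul_le_mul_of_nonneg_left ?_ hc.le
        refine (norm_mul_le _ _).trans ?_
        exact (mul_le_of_le_one_right (norm_nonneg _) (Tt_norm _)).trans hEan
      have h2 : ‖Pop hS μ * E‖ ≤ 1 - c :=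
        (norm_mul_le _ _).trans ((mul_le_of_le_one_left (norm_nonneg _) (Pop_norm hS hμ)).trans hE)
      linarith
    · rw [List.length_cons, pow_succ', heq, mul_add, List.prod_cons, Tt_mul, ← add_assoc]
      congr 1
      rw [hPa, add_mul, smul_mul_smul_comm, mul_smul_comm]

theorem binom_op (P : HH Γ →L[ℝ] HH Γ) (N : ℕ) :
    (1 + P) ^ N = ∑ m ∈ Finset.range (N + 1), (N.choose m : ℝ) • P ^ m := by
  rw [add_comm, (Commute.one_right P).add_pow]
  refine Finset.sum_congr rfl fun m _ => ?_
  ext ξ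
  simp [← Nat.cast_smul_eq_nsmul ℝ]

theorem binom_norm (P : HH Γ →L[ℝ] HH Γ) (hP : ‖P‖ ≤ 1) (N k : ℕ) (hk : 1 ≤ k) (hkN : k ≤ N)
    (ξ : HH Γ) : ‖((1 + P) ^ N) ξ‖ ≤ ‖ξ + (P ^ k) ξ‖ + (2 ^ N - 2) * ‖ξ‖ := by
  classical
  have hPm : ∀ m : ℕ, ‖(P ^ m) ξ‖ ≤ ‖ξ‖ := fun m => by
    refine (ContinuousLinearMap.le_opNorm _ _).trans ?_
    refine mul_le_of_le_one_left (norm_nonneg _) ?_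
    rcases Nat.eq_zero_or_pos m with h | h
    · subst h
      exact ContinuousLinearMap.norm_id_le
    · exact (norm_pow_le' _ h).trans (pow_le_one₀ (norm_nonneg _) hP)
  let r : ℕ → ℝ := fun m => (N.choose m : ℝ) - (if m = 0 then 1 else 0) - (if m = k then 1 else 0)
  have hr : ∀ m ∈ Finset.range (N + 1), 0 ≤ r m := fun m hm => by
    have : 1 ≤ N.choose m := Nat.choose_pos (by simpa [Nat.lt_succ_iff] using hm)
    have : (1:ℝ) ≤ N.choose m := by exact_mod_cast this
    simp only [r]
    split_ifs
    · omega
    all_goals linarith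
  have hsum : ∑ m ∈ Finset.range (N + 1), r m = 2 ^ N - 2 := by
    simp only [r, Finset.sum_sub_distrib]
    rw [← Nat.cast_sum, Nat.sum_range_choose]
    simp [hkN]; ring
  have e : ((1 + P) ^ N) ξ = (ξ + (P ^ k) ξ) + ∑ m ∈ Finset.range (N + 1), r m • (P ^ m) ξ := by
    rw [binom_op]
    simp only [r, sub_smul, Finset.sum_sub_distrib, ite_smul, one_smul, zero_smul,
      sum_apply, smul_apply]
    simp [hkN]
  rw [e, ← hsum, Finset.sum_mul]
  refine (norm_add_le _ _).trans (add_le_add le_rfl (norm_sum_le_of_le _ fun m hm => ?_))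
  rw [norm_smul, Real.norm_of_nonneg (hr m hm)]
  exact mul_le_mul_of_nonneg_left (hPm m) (hr m hm)

theorem lazy_contract {S : Set Γ} {δ : ℝ} (hS : IsGenSet S) (hδ : IsHyperbolic S δ)
    (hne : Nonelementary Γ) {μ : Γ → ℝ} (hμ : IsRWMeasure S μ) :
    ∃ N : ℕ, 1 ≤ N ∧ ∃ η : ℝ, 0 < η ∧ η < 1 ∧ ∀ ξ : HH Γ,
      ‖((1 + Pop hS μ) ^ N) ξ‖ ≤ 2 ^ N * (1 - η) * ‖ξ‖ := by
  classical
  obtain ⟨F, ε, hε, hε1, hF⟩ := spectral_gap hS hδ hne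
  choose L hL0 hLp hLw using hμ.nondeg
  choose c hc0 hc1 E hE heq using fun w => Pop_list hS hμ (L w) (hLp w)
  obtain ⟨w1, hw1, -⟩ := hF 0
  have hne' : F.Nonempty := ⟨w1, hw1⟩
  obtain ⟨w0, hw0, hmin⟩ := F.exists_min_image c hne'
  set N := F.sup (fun w => (L w).length) with hN
  have hlen : ∀ w, 1 ≤ (L w).length := fun w => List.length_pos_iff.mpr (hL0 w)
  have hle : ∀ w ∈ F, (L w).length ≤ N := fun w hw => Finset.le_sup (f := fun w => (L w).length) hw
  have h2N : (1:ℝ) ≤ 2 ^ N := one_le_pow₀ (by norm_num)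
  refine ⟨N, (hlen w0).trans (hle w0 hw0), c w0 * ε ^ 2 / 4 / 2 ^ N, by have := hc0 w0; positivity, ?_, fun ξ => ?_⟩
  · rw [div_lt_one (by positivity)]
    have := hc0 w0
    have := hc1 w0
    nlinarith
  · obtain ⟨w, hw, hgap⟩ := hF ξ
    refine (binom_norm _ (Pop_norm hS hμ) N _ (hlen w) (hle w hw) ξ).trans ?_
    rw [heq w, hLw]
    have hpar := parallelogram_law_with_norm ℝ ξ (Rt w ξ)
    rw [(Rt w).norm_map] at hpar
    have hsum : ‖ξ + Rt w ξ‖ ≤ (2 - ε ^ 2 / 4) * ‖ξ‖ := by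
      refine le_of_sq_le_sq ?_ (mul_nonneg (by nlinarith) (norm_nonneg ξ))
      have : (ε * ‖ξ‖) ^ 2 ≤ ‖ξ - Rt w ξ‖ ^ 2 := by gcongr
      nlinarith [sq_nonneg (ε ^ 2 * ‖ξ‖)]
    have h1 : ‖ξ + (c w • Tt w + E w) ξ‖ ≤ (2 - c w * ε ^ 2 / 4) * ‖ξ‖ := by
      have e : ξ + (c w • Tt w + E w) ξ = c w • (ξ + Rt w ξ) + (1 - c w) • ξ + E w ξ := by
        simp only [add_apply, smul_apply, Tt_apply]
        module
      rw [e]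
      refine norm_add₃_le.trans ?_
      rw [norm_smul, norm_smul, Real.norm_of_nonneg (hc0 w).le,
        Real.norm_of_nonneg (sub_nonneg.mpr (hc1 w))]
      have := (E w).le_of_opNorm_le (hE w) ξ
      have := mul_le_mul_of_nonneg_left hsum (hc0 w).le
      nlinarith
    have h2 : c w0 ≤ c w := hmin w hw
    have h3 : 2 ^ N * (1 - c w0 * ε ^ 2 / 4 / 2 ^ N) = 2 ^ N - c w0 * ε ^ 2 / 4 := by
      field_simp
    rw [h3]
    have h4 : c w0 * ε ^ 2 / 4 * ‖ξ‖ ≤ c w * ε ^ 2 / 4 * ‖ξ‖ := by gcongr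
    nlinarith

/-- lazy operator powers decay -/
theorem lazy_decay {S : Set Γ} {δ : ℝ} (hS : IsGenSet S) (hδ : IsHyperbolic S δ)
    (hne : Nonelementary Γ) {μ : Γ → ℝ} (hμ : IsRWMeasure S μ) :
    ∃ θ : ℝ, 0 < θ ∧ θ < 1 ∧ ∃ C : ℝ, 0 < C ∧ ∀ (n : ℕ) (ξ : HH Γ),
      ‖((1 + Pop hS μ) ^ n) ξ‖ ≤ C * (2 * θ) ^ n * ‖ξ‖ := by
  obtain ⟨N, hN, η, hη, hη1, hc⟩ := lazy_contract hS hδ hne hμ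
  have hθ0 : 0 < 1 - η := by linarith
  have hNN : N ≠ 0 := by omega
  have hpow : ((1 - η) ^ ((N:ℝ)⁻¹)) ^ N = 1 - η := Real.rpow_inv_natCast_pow hθ0.le hNN
  have hpos : 0 < (1 - η) ^ ((N:ℝ)⁻¹) := Real.rpow_pos_of_pos hθ0 _
  set θ := (1 - η) ^ ((N:ℝ)⁻¹) with hθ
  have hlt : θ < 1 := Real.rpow_lt_one hθ0.le (by linarith) (by positivity)
  refine ⟨θ, hpos, hlt, (θ ^ N)⁻¹, by positivity, fun n ξ => ?_⟩
  have hQ : ∀ (r : ℕ) (ξ : HH Γ), ‖((1 + Pop hS μ) ^ r) ξ‖ ≤ 2 ^ r * ‖ξ‖ := fun r => by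
    induction r with
    | zero => intro ξ; simp
    | succ r ih =>
      intro ξ
      rw [pow_succ]
      refine (ih _).trans ?_
      have : ‖(1 + Pop hS μ) ξ‖ ≤ 2 * ‖ξ‖ := by
        have e : (1 + Pop hS μ) ξ = ξ + Pop hS μ ξ := rfl
        rw [e]
        refine (norm_add_le _ _).trans ?_
        have := (Pop hS μ).le_of_opNorm_le (Pop_norm hS hμ) ξ
        linarith
      rw [pow_succ, mul_assoc]
      exact mul_le_mul_of_nonneg_left this (by positivity)
  have hB : ∀ (q : ℕ) (ξ : HH Γ), ‖((1 + Pop hS μ) ^ (N * q)) ξ‖ ≤ (2 ^ N * (1 - η)) ^ q * ‖ξ‖ := fun q => by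
    induction q with
    | zero => intro ξ; simp
    | succ q ih =>
      intro ξ
      rw [Nat.mul_succ, pow_add]
      refine (ih _).trans ?_
      rw [pow_succ, mul_assoc ((2 ^ N * (1 - η)) ^ q)]
      exact mul_le_mul_of_nonneg_left (hc ξ) (by positivity)
  have hn := Nat.div_add_mod n N
  set q := n / N
  set r := n % N with hr
  have hrN : r ≤ N := (Nat.mod_lt _ (by omega)).le
  rw [← hn, pow_add]
  refine (hB q _).trans ?_
  have h1 := hQ r ξ
  have : (2 ^ N * (1 - η)) ^ q * (2 ^ r * ‖ξ‖) ≤ (θ ^ N)⁻¹ * (2 * θ) ^ (N * q + r) * ‖ξ‖ := by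
    have h2 : (2 ^ N * (1 - η)) ^ q = (2 * θ) ^ (N * q) := by rw [← hpow, ← mul_pow, ← pow_mul]
    have h3 : (2:ℝ) ^ r ≤ (θ ^ N)⁻¹ * (2 * θ) ^ r := by
      rw [mul_pow, le_inv_mul_iff₀ (by positivity), mul_comm]
      exact mul_le_mul_of_nonneg_left (pow_le_pow_of_le_one hpos.le hlt.le hrN) (by positivity)
    rw [h2, pow_add]
    calc _ ≤ (2 * θ) ^ (N * q) * (((θ ^ N)⁻¹ * (2 * θ) ^ r) * ‖ξ‖) := by gcongr
      _ = _ := by ring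
  exact (mul_le_mul_of_nonneg_left h1 (by positivity)).trans this

theorem ptrans_succ {S : Set Γ} (hS : IsGenSet S) {μ : Γ → ℝ} (hμ : IsRWMeasure S μ) (n : ℕ)
    (x y : Γ) : ptrans μ (n + 1) x y = ∑ g ∈ hS.1.toFinset, μ g * ptrans μ n x (y * g⁻¹) := by
  simp only [ptrans]
  rw [← ((Equiv.inv Γ).trans (Equiv.mulLeft y)).tsum_eq]
  rw [tsum_eq_sum (s := hS.1.toFinset)]
  · refine Finset.sum_congr rfl fun g _ => ?_
    simp [mul_comm]
  · intro g hg
    have : μ g = 0 := by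
      by_contra h
      exact hg (by simpa using hμ.support_subset g h)
    simp [this]

theorem ptransR_succ {S : Set Γ} (hS : IsGenSet S) {μ : Γ → ℝ} (hμ : IsRWMeasure S μ) (Δ : Set Γ)
    (n : ℕ) (x y : Γ) : ptransR μ Δ (n + 1) x y =
      open Classical in
      if y ∈ Δ then ∑ g ∈ hS.1.toFinset, μ g * ptransR μ Δ n x (y * g⁻¹) else 0 := by
  simp only [ptransR]
  congr 1
  rw [← ((Equiv.inv Γ).trans (Equiv.mulLeft y)).tsum_eq]
  rw [tsum_eq_sum (s := hS.1.toFinset)]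
  · refine Finset.sum_congr rfl fun g _ => ?_
    simp [mul_comm]
  · intro g hg
    have : μ g = 0 := by
      by_contra h
      exact hg (by simpa using hμ.support_subset g h)
    simp [this]

theorem ptrans_nonneg {S : Set Γ} {μ : Γ → ℝ} (hμ : IsRWMeasure S μ) (n : ℕ)
    (x y : Γ) : 0 ≤ ptrans μ n x y := by
  induction n generalizing y with
  | zero => simp only [ptrans]; split_ifs <;> simp
  | succ n ih => 
    rw [ptrans]
    exact tsum_nonneg fun z => mul_nonneg (ih z) (hμ.nonneg _)

theorem ptransR_nonneg {S : Set Γ} {μ : Γ → ℝ} (hμ : IsRWMeasure S μ) (Δ : Set Γ) (n : ℕ)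
    (x y : Γ) : 0 ≤ ptransR μ Δ n x y := by
  induction n generalizing y with
  | zero => simp only [ptransR]; split_ifs <;> simp
  | succ n ih => 
    simp only [ptransR]
    split_ifs
    · exact tsum_nonneg fun z => mul_nonneg (ih z) (hμ.nonneg _)
    · exact le_rfl

theorem ptransR_le {S : Set Γ} (hS : IsGenSet S) {μ : Γ → ℝ} (hμ : IsRWMeasure S μ) (Δ : Set Γ)
    (n : ℕ) (x y : Γ) : ptransR μ Δ n x y ≤ ptrans μ n x y := by
  classical
  induction n generalizing y with
  | zero =>
    simp only [ptransR, ptrans]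
    by_cases h : x = y
    · by_cases h2 : x ∈ Δ <;> simp only [h, true_and, if_true] <;> split_ifs <;> simp
    · simp [h]
  | succ n ih =>
    rw [ptransR_succ hS hμ, ptrans_succ hS hμ]
    split_ifs
    · exact Finset.sum_le_sum fun g _ => mul_le_mul_of_nonneg_left (ih _) (hμ.nonneg g)
    · exact Finset.sum_nonneg fun g _ => mul_nonneg (hμ.nonneg g) (ptrans_nonneg hμ _ _ _)

open Classical in
theorem Tt_single (g y : Γ) : Tt g (lp.single 2 y (1:ℝ) : HH Γ) = lp.single 2 (y * g⁻¹) (1:ℝ) := by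
  ext x
  rw [Tt_apply, Rt_apply]
  simp only [lp.single_apply, Pi.single_apply, eq_mul_inv_iff_mul_eq]

open Classical in
theorem Pop_pow_single {S : Set Γ} (hS : IsGenSet S) {μ : Γ → ℝ} (hμ : IsRWMeasure S μ) (n : ℕ)
    (x y : Γ) : (((Pop hS μ) ^ n) (lp.single 2 y (1:ℝ) : HH Γ)) x = ptrans μ n x y := by
  induction n generalizing y with
  | zero =>
    simp [ptrans, Pi.single_apply]
  | succ n ih =>
    rw [pow_succ, ptrans_succ hS hμ]
    have e : (Pop hS μ) (lp.single 2 y (1:ℝ) : HH Γ)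
        = ∑ g ∈ hS.1.toFinset, μ g • (lp.single 2 (y * g⁻¹) (1:ℝ) : HH Γ) := by
      simp only [Pop, sum_apply, smul_apply, Tt_single]
    change (((Pop hS μ) ^ n) ((Pop hS μ) (lp.single 2 y (1:ℝ) : HH Γ))) x = _
    rw [e, map_sum, lp.coeFn_sum, Finset.sum_apply]
    refine Finset.sum_congr rfl fun g _ => ?_
    rw [map_smul, lp.coeFn_smul, Pi.smul_apply, ih, smul_eq_mul]

theorem ptrans_decay {S : Set Γ} {δ : ℝ} (hS : IsGenSet S) (hδ : IsHyperbolic S δ)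
    (hne : Nonelementary Γ) {μ : Γ → ℝ} (hμ : IsRWMeasure S μ) :
    ∃ θ : ℝ, 0 < θ ∧ θ < 1 ∧ ∃ C : ℝ, 0 < C ∧ ∀ (n : ℕ) (x y : Γ), ptrans μ n x y ≤ C * θ ^ n := by
  classical
  obtain ⟨θ, h0, h1, C, hC, hdec⟩ := lazy_decay hS hδ hne hμ
  obtain ⟨B, hB⟩ := (tendsto_self_mul_const_pow_of_lt_one h0.le h1).bddAbove_range
  have hB' : ∀ n : ℕ, n * θ ^ n ≤ B := fun n => hB ⟨n, rfl⟩
  have hB0 : 0 ≤ B := by simpa using hB' 0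
  refine ⟨θ, h0, h1, (2 * B + 1) * C, by positivity, fun n x y => ?_⟩
  have h2 := hdec (2 * n) (lp.single 2 y (1:ℝ))
  rw [lp.norm_single (by norm_num)] at h2
  have h3 := lp.norm_apply_le_norm (p := 2) (by norm_num) (((1 + Pop hS μ) ^ (2 * n)) (lp.single 2 y (1:ℝ))) x
  have h4 : ((1 + Pop hS μ) ^ (2 * n)) (lp.single 2 y (1:ℝ)) x
      = ∑ m ∈ Finset.range (2 * n + 1), ((2 * n).choose m : ℝ) * ptrans μ m x y := by
    rw [binom_op, sum_apply, lp.coeFn_sum, Finset.sum_apply]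
    refine Finset.sum_congr rfl fun m _ => ?_
    rw [smul_apply, lp.coeFn_smul, Pi.smul_apply, Pop_pow_single hS hμ, smul_eq_mul]
  have h5 : (n.centralBinom : ℝ) * ptrans μ n x y ≤
      ∑ m ∈ Finset.range (2 * n + 1), ((2 * n).choose m : ℝ) * ptrans μ m x y := by
    rw [Nat.centralBinom]
    exact Finset.single_le_sum (f := fun m => ((2 * n).choose m : ℝ) * ptrans μ m x y)
      (fun m _ => mul_nonneg (by positivity) (ptrans_nonneg hμ _ _ _)) (by simp; omega)
  have h6 : (n.centralBinom : ℝ) * ptrans μ n x y ≤ C * (2 * θ) ^ (2 * n) := by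
    rw [← h4] at h5
    have := (le_abs_self _).trans h3
    rw [norm_one, mul_one] at h2
    linarith
  have h7 : (4:ℝ) ^ n ≤ (2 * n + 1) * n.centralBinom := by
    rcases Nat.eq_zero_or_pos n with h | h
    · subst h; simp
    · have := Nat.four_pow_le_two_mul_self_mul_centralBinom n h
      have : (4:ℝ) ^ n ≤ 2 * n * n.centralBinom := by exact_mod_cast this
      nlinarith [(Nat.cast_nonneg n.centralBinom : (0:ℝ) ≤ _)]
  have hp := ptrans_nonneg hμ n x y
  have h8 : (4:ℝ) ^ n * ptrans μ n x y ≤ 4 ^ n * ((2 * n + 1) * (C * θ ^ (2 * n))) := by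
    calc (4:ℝ) ^ n * ptrans μ n x y ≤ (2 * n + 1) * n.centralBinom * ptrans μ n x y := by gcongr
      _ = (2 * n + 1) * (n.centralBinom * ptrans μ n x y) := by ring
      _ ≤ (2 * n + 1) * (C * (2 * θ) ^ (2 * n)) := by gcongr
      _ = _ := by
        rw [mul_pow, pow_mul 2 2 n]; norm_num; ring
  have h9 := le_of_mul_le_mul_left h8 (by positivity)
  refine h9.trans ?_
  have h10 : θ ^ n ≤ 1 := pow_le_one₀ h0.le h1.le
  have h11 : (2 * n + 1) * θ ^ n ≤ 2 * B + 1 := by nlinarith [hB' n]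
  calc (2 * n + 1) * (C * θ ^ (2 * n)) = ((2 * n + 1) * θ ^ n) * (C * θ ^ n) := by ring
    _ ≤ (2 * B + 1) * (C * θ ^ n) := by gcongr
    _ = _ := by ring

theorem specRad_le {S : Set Γ} {μ : Γ → ℝ} (hμ : IsRWMeasure S μ) {θ C : ℝ} (h0 : 0 < θ)
    (hC : 0 < C) (h : ∀ (n : ℕ) (x y : Γ), ptrans μ n x y ≤ C * θ ^ n) {θ' : ℝ} (hθ : θ < θ') :
    specRad μ ≤ θ' := by
  have h0' : 0 < θ' := h0.trans hθ
  refine limsup_le_of_le ?_ ?_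
  · refine IsCoboundedUnder.of_frequently_ge (a := 0) ?_
    exact Frequently.of_forall fun n => Real.rpow_nonneg (ptrans_nonneg hμ _ _ _) _
  · have ht : Tendsto (fun n : ℕ => (θ / θ') ^ n) atTop (𝓝 0) :=
      tendsto_pow_atTop_nhds_zero_of_lt_one (by positivity) (by rwa [div_lt_one h0'])
    filter_upwards [ht.eventually_lt_const (show 0 < C⁻¹ by positivity), eventually_gt_atTop 0]
      with n hn hn0
    rw [← Real.pow_rpow_inv_natCast h0'.le hn0.ne']
    refine Real.rpow_le_rpow (ptrans_nonneg hμ _ _ _) ((h n 1 1).trans ?_) (by positivity)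
    rw [div_pow, div_lt_iff₀ (by positivity), lt_inv_mul_iff₀ hC] at hn
    exact hn.le

/-- summary of the spectral part -/
theorem spectral_summary {S : Set Γ} {δ : ℝ} (hS : IsGenSet S) (hδ : IsHyperbolic S δ)
    (hne : Nonelementary Γ) {μ : Γ → ℝ} (hμ : IsRWMeasure S μ) :
    ∃ s : ℝ, 1 < s ∧ s * specRad μ < 1 ∧ ∃ M : ℝ, ∀ (Δ : Set Γ) (x y : Γ),
      Summable (fun n => ptransR μ Δ n x y * s ^ n) ∧ ∑' n, ptransR μ Δ n x y * s ^ n ≤ M := by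
  obtain ⟨θ, h0, h1, C, hC, hdec⟩ := ptrans_decay hS hδ hne hμ
  obtain ⟨θ', h2, h3⟩ := exists_between h1
  have h0' : 0 < θ' := h0.trans h2
  obtain ⟨s, hs1, hs2⟩ := exists_between ((one_lt_inv₀ h0').mpr h3)
  have hs0 : 0 < s := by linarith
  have hsθ' : s * θ' < 1 := by
    rwa [lt_inv_comm₀ hs0 h0', ← one_div, lt_div_iff₀ hs0, mul_comm] at hs2
  have hsθ : θ * s < 1 := by nlinarith
  refine ⟨s, hs1, ?_, ∑' n, C * (θ * s) ^ n, fun Δ x y => ?_⟩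
  · have := specRad_le hμ h0 hC hdec h2
    nlinarith
  · have hsum : Summable (fun n => C * (θ * s) ^ n) :=
      (summable_geometric_of_lt_one (by positivity) hsθ).mul_left C
    have hle : ∀ n, ptransR μ Δ n x y * s ^ n ≤ C * (θ * s) ^ n := fun n => by
      rw [mul_pow, ← mul_assoc]
      exact mul_le_mul_of_nonneg_right ((ptransR_le hS hμ Δ n x y).trans (hdec n x y)) (by positivity)
    have hsm : Summable (fun n => ptransR μ Δ n x y * s ^ n) :=
      Summable.of_nonneg_of_le (fun n => mul_nonneg (ptransR_nonneg hμ _ _ _ _) (by positivity)) hle hsum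
    exact ⟨hsm, hsm.tsum_le_tsum hle hsum⟩

open Classical in
/-- extended nonnegative version of `ptransR` -/
noncomputable def pE (m : Γ → ℝ≥0∞) (Δ : Set Γ) : ℕ → Γ → Γ → ℝ≥0∞
  | 0 => fun x y => if x = y ∧ x ∈ Δ then 1 else 0
  | n + 1 => fun x y => if y ∈ Δ then ∑' z : Γ, pE m Δ n x z * m (z⁻¹ * y) else 0

open Classical in
/-- paths staying in `D` after time zero -/
noncomputable def lE (m : Γ → ℝ≥0∞) (D : Set Γ) : ℕ → Γ → Γ → ℝ≥0∞
  | 0 => fun z w => if w ∈ D then m (z⁻¹ * w) else 0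
  | n + 1 => fun z w => if w ∈ D then ∑' u : Γ, lE m D n z u * m (u⁻¹ * w) else 0

/-- Green generating function -/
noncomputable def GE (m : Γ → ℝ≥0∞) (Δ : Set Γ) (x y : Γ) (t : ℝ≥0∞) : ℝ≥0∞ :=
  ∑' n, pE m Δ n x y * t ^ n

/-- last exit generating function -/
noncomputable def LE (m : Γ → ℝ≥0∞) (D : Set Γ) (x y : Γ) (t : ℝ≥0∞) : ℝ≥0∞ :=
  ∑' n, lE m D n x y * t ^ (n + 1)

theorem pE_zero_of_not_mem {m : Γ → ℝ≥0∞} {Δ : Set Γ} {n : ℕ} {x y : Γ} (hy : y ∉ Δ) :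
    pE m Δ n x y = 0 := by
  cases n with
  | zero =>
    simp only [pE]
    rw [if_neg]
    rintro ⟨rfl, h⟩
    exact hy h
  | succ n => simp [pE, hy]

theorem pE_succ {m : Γ → ℝ≥0∞} {Δ : Set Γ} {n : ℕ} {x y : Γ} (hy : y ∈ Δ) :
    pE m Δ (n + 1) x y = ∑' z : Γ, pE m Δ n x z * m (z⁻¹ * y) := by
  rw [pE]
  simp only [hy, if_true]

theorem lE_zero_of_not_mem {m : Γ → ℝ≥0∞} {D : Set Γ} {n : ℕ} {x y : Γ} (hy : y ∉ D) :
    lE m D n x y = 0 := by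
  cases n <;> simp [lE, hy]

theorem GE_zero_of_not_mem {m : Γ → ℝ≥0∞} {Δ : Set Γ} {x y : Γ} {t : ℝ≥0∞} (hy : y ∉ Δ) :
    GE m Δ x y t = 0 := by
  simp [GE, pE_zero_of_not_mem hy]

theorem lastExit_pE (m : Γ → ℝ≥0∞) (Δ V : Set Γ) (a : Γ) (ha : a ∉ V) (n : ℕ) (w : Γ) (hw : w ∈ V) :
    pE m Δ (n + 1) a w = ∑ p ∈ Finset.HasAntidiagonal.antidiagonal n,
      ∑' z : (Vᶜ : Set Γ), pE m Δ p.1 a z * lE m (Δ ∩ V) p.2 z w := by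
  induction n generalizing w with
  | zero =>
    by_cases hΔ : w ∈ Δ
    · have e1 : pE m Δ (0 + 1) a w = ∑' u, pE m Δ 0 a u * m (u⁻¹ * w) := by
        exact pE_succ hΔ
      rw [e1, ← ENNReal.summable.tsum_add_tsum_compl (s := V) ENNReal.summable]
      have e2 : ∑' u : V, pE m Δ 0 a u * m ((u:Γ)⁻¹ * w) = 0 := by
        rw [ENNReal.tsum_eq_zero]
        intro u
        have : a ≠ u := fun h => ha (h ▸ u.2)
        simp [pE, this]
      simp [e2, lE, hw, hΔ]
    · rw [pE_zero_of_not_mem hΔ]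
      simp [lE, hΔ]
  | succ n ih =>
    by_cases hΔ : w ∈ Δ
    · have e1 : pE m Δ (n + 1 + 1) a w = ∑' u, pE m Δ (n + 1) a u * m (u⁻¹ * w) := by
        exact pE_succ hΔ
      rw [e1, ← ENNReal.summable.tsum_add_tsum_compl (s := V) ENNReal.summable,
        Finset.Nat.sum_antidiagonal_succ', add_comm]
      congr 1
      · refine tsum_congr fun z => ?_
        simp [lE, hw, hΔ]
      · have e2 : ∀ u : V, pE m Δ (n + 1) a u * m ((u:Γ)⁻¹ * w) =
            ∑ p ∈ Finset.HasAntidiagonal.antidiagonal n, ∑' z : (Vᶜ : Set Γ),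
              pE m Δ p.1 a z * (lE m (Δ ∩ V) p.2 z u * m ((u:Γ)⁻¹ * w)) := fun u => by
          rw [ih u u.2, Finset.sum_mul]
          refine Finset.sum_congr rfl fun p _ => ?_
          rw [← ENNReal.tsum_mul_right]
          simp_rw [mul_assoc]
        simp_rw [e2]
        rw [Summable.tsum_finsetSum (fun _ _ => ENNReal.summable)]
        refine Finset.sum_congr rfl fun p _ => ?_
        rw [ENNReal.tsum_comm]
        refine tsum_congr fun z => ?_
        rw [ENNReal.tsum_mul_left]
        congr 1
        have e3 : lE m (Δ ∩ V) (p.2 + 1) z w = ∑' u, lE m (Δ ∩ V) p.2 z u * m (u⁻¹ * w) := by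
          rw [lE]; simp [hΔ, hw]
        rw [e3]
        refine tsum_subtype_eq_of_support_subset (f := fun u => lE m (Δ ∩ V) p.2 z u * m (u⁻¹ * w)) fun u hu => ?_
        by_contra h
        apply hu
        simp [lE_zero_of_not_mem (m := m) (n := p.2) (x := (z:Γ)) (fun h' : u ∈ Δ ∩ V => h h'.2)]
    · rw [pE_zero_of_not_mem hΔ]
      simp [lE_zero_of_not_mem (m := m) (fun h' : w ∈ Δ ∩ V => hΔ h'.1)]

theorem tsum_antidiag (f : ℕ × ℕ → ℝ≥0∞) :
    ∑' n, ∑ p ∈ Finset.HasAntidiagonal.antidiagonal n, f p = ∑' a, ∑' b, f (a, b) := by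
  rw [← ENNReal.tsum_prod, ← (Finset.HasAntidiagonal.sigmaAntidiagonalEquivProd (A := ℕ)).tsum_eq, ENNReal.tsum_sigma']
  refine tsum_congr fun n => ?_
  rw [← Finset.tsum_subtype]
  rfl

theorem lastExit_GE (m : Γ → ℝ≥0∞) (Δ V : Set Γ) (a : Γ) (ha : a ∉ V) (w : Γ) (hw : w ∈ V) (t : ℝ≥0∞) :
    GE m Δ a w t = ∑' z : (Vᶜ : Set Γ), GE m Δ a z t * LE m (Δ ∩ V) z w t := by
  have h0 : pE m Δ 0 a w = 0 := by
    have : a ≠ w := fun h => ha (h ▸ hw)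
    simp [pE, this]
  rw [GE, tsum_eq_zero_add' ENNReal.summable, h0, zero_mul, zero_add]
  have e1 : ∀ n, pE m Δ (n + 1) a w * t ^ (n + 1) = ∑ p ∈ Finset.HasAntidiagonal.antidiagonal n,
      ∑' z : (Vᶜ : Set Γ), (pE m Δ p.1 a z * t ^ p.1) * (lE m (Δ ∩ V) p.2 z w * t ^ (p.2 + 1)) := fun n => by
    rw [lastExit_pE m Δ V a ha n w hw, Finset.sum_mul]
    refine Finset.sum_congr rfl fun p hp => ?_
    rw [← ENNReal.tsum_mul_right]
    refine tsum_congr fun z => ?_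
    rw [← Finset.HasAntidiagonal.mem_antidiagonal.mp hp]
    ring
  simp_rw [e1]
  rw [tsum_antidiag (fun p => ∑' z : (Vᶜ : Set Γ), (pE m Δ p.1 a z * t ^ p.1) * (lE m (Δ ∩ V) p.2 z w * t ^ (p.2 + 1)))]
  simp_rw [GE, LE, ← ENNReal.tsum_mul_right, ← ENNReal.tsum_mul_left]
  rw [ENNReal.tsum_comm (α := (Vᶜ : Set Γ))]
  refine tsum_congr fun k => ?_
  rw [ENNReal.tsum_comm]

theorem pE_semigroup (m : Γ → ℝ≥0∞) (Δ : Set Γ) (n k : ℕ) (x z y : Γ) :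
    pE m Δ n x z * pE m Δ k z y ≤ pE m Δ (n + k) x y := by
  induction k generalizing y with
  | zero =>
    by_cases h : z = y ∧ z ∈ Δ
    · obtain ⟨rfl, h⟩ := h
      simp [pE, h]
    · have : pE m Δ 0 z y = 0 := by simp only [pE]; rw [if_neg h]
      simp [this]
  | succ k ih =>
    by_cases hy : y ∈ Δ
    · have e : ∀ j v, pE m Δ (j + 1) v y = ∑' u, pE m Δ j v u * m (u⁻¹ * y) := fun j v => by
        exact pE_succ hy
      rw [← add_assoc, e, e, ← ENNReal.tsum_mul_left]
      refine ENNReal.tsum_le_tsum fun u => ?_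
      rw [← mul_assoc]
      gcongr
      exact ih u
    · simp [pE_zero_of_not_mem hy]

theorem lE_le_pE (m : Γ → ℝ≥0∞) (Δ V : Set Γ) (n : ℕ) (z w : Γ) (hz : z ∈ Δ) :
    lE m (Δ ∩ V) n z w ≤ pE m Δ (n + 1) z w := by
  by_cases hw : w ∈ Δ ∩ V
  · have e : ∀ j v, pE m Δ (j + 1) v w = ∑' u, pE m Δ j v u * m (u⁻¹ * w) := fun j v => by
      exact pE_succ hw.1
    induction n generalizing w with
    | zero =>
      rw [e]
      refine le_trans ?_ (ENNReal.le_tsum z)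
      simp [lE, pE, hw.1, hw.2, hz]
    | succ n ih =>
      rw [e, lE]
      simp only [hw, if_true]
      refine ENNReal.tsum_le_tsum fun u => ?_
      gcongr
      by_cases hu : u ∈ Δ ∩ V
      · refine ih u hu fun j v => ?_
        exact pE_succ hu.1
      · simp [lE_zero_of_not_mem hu]
  · simp [lE_zero_of_not_mem hw]

theorem LE_le_GE (m : Γ → ℝ≥0∞) (Δ V : Set Γ) (z w : Γ) (hz : z ∈ Δ) (t : ℝ≥0∞) :
    LE m (Δ ∩ V) z w t ≤ GE m Δ z w t := by
  rw [GE, tsum_eq_zero_add' ENNReal.summable]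
  refine le_trans (ENNReal.tsum_le_tsum fun n => ?_) (le_add_of_nonneg_left zero_le)
  gcongr
  exact lE_le_pE m Δ V n z w hz

theorem lE_dist {S : Set Γ} (hS : IsGenSet S) {m : Γ → ℝ≥0∞} (hm : ∀ g, m g ≠ 0 → g ∈ S) {D : Set Γ}
    {n : ℕ} {z w : Γ} (h : lE m D n z w ≠ 0) :
    wl S (z⁻¹ * w) ≤ n + 1 ∧ ∃ u ∈ D, wl S (z⁻¹ * u) ≤ 1 := by
  have hw : w ∈ D := by
    by_contra hw
    exact h (lE_zero_of_not_mem hw)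
  induction n generalizing w with
  | zero =>
    simp only [lE, hw, if_true] at h
    have := wl_mem (hm _ h)
    exact ⟨by simpa using this, w, hw, this⟩
  | succ n ih =>
    simp only [lE, hw, if_true] at h
    rw [Ne, ENNReal.tsum_eq_zero] at h
    push Not at h
    obtain ⟨u, hu⟩ := h
    have h1 : lE m D n z u ≠ 0 := left_ne_zero_of_mul hu
    have h2 := wl_mem (hm _ (right_ne_zero_of_mul hu))
    have huD : u ∈ D := by
      by_contra hw
      exact h1 (lE_zero_of_not_mem hw)
    obtain ⟨h3, h4⟩ := ih h1 huD
    refine ⟨?_, h4⟩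
    have := wl_tri hS z u w
    omega

theorem LE_shift {S : Set Γ} (hS : IsGenSet S) {m : Γ → ℝ≥0∞} (hm : ∀ g, m g ≠ 0 → g ∈ S) {D : Set Γ}
    {κ : ℕ} {z w : Γ} (h : κ ≤ wl S (z⁻¹ * w)) {s : ℝ≥0∞} (hs : 1 ≤ s) (hs' : s ≠ ⊤) :
    LE m D z w 1 ≤ s⁻¹ ^ κ * LE m D z w s := by
  rw [LE, LE, ← ENNReal.tsum_mul_left]
  refine ENNReal.tsum_le_tsum fun n => ?_
  by_cases h0 : lE m D n z w = 0
  · simp [h0]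
  · have h1 := (lE_dist hS hm h0).1
    rw [one_pow, mul_one]
    have : 1 ≤ s⁻¹ ^ κ * s ^ (n + 1) := by
      calc (1:ℝ≥0∞) = s⁻¹ ^ κ * s ^ κ := by
            rw [← mul_pow, ENNReal.inv_mul_cancel (by positivity) hs', one_pow]
        _ ≤ _ := by gcongr <;> first | exact hs | omega
    calc lE m D n z w = lE m D n z w * 1 := (mul_one _).symm
      _ ≤ lE m D n z w * (s⁻¹ ^ κ * s ^ (n + 1)) := by gcongr
      _ = _ := by ring

theorem GE_mono (m : Γ → ℝ≥0∞) (Δ : Set Γ) (x y : Γ) {s t : ℝ≥0∞} (h : s ≤ t) :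
    GE m Δ x y s ≤ GE m Δ x y t := by
  refine ENNReal.tsum_le_tsum fun n => ?_
  gcongr

theorem one_le_GE (m : Γ → ℝ≥0∞) (Δ : Set Γ) (x : Γ) (hx : x ∈ Δ) (t : ℝ≥0∞) :
    1 ≤ GE m Δ x x t := by
  refine le_trans ?_ (ENNReal.le_tsum 0)
  simp [pE, hx]

theorem pE_list {S : Set Γ} {m : Γ → ℝ≥0∞} (hm : ∀ g, m g ≠ 0 → g ∈ S)
    (l : List Γ) (hl : ∀ x ∈ l, m x ≠ 0) (z : Γ) (Δ : Set Γ)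
    (hΔ : ∀ h, wl S h ≤ l.length → z * h ∈ Δ) :
    (l.map m).prod ≤ pE m Δ l.length z (z * l.prod) := by
  induction l using List.reverseRecOn with
  | nil =>
    have : z ∈ Δ := by simpa using hΔ 1 (by rw [wl_one]; simp)
    simp [pE, this]
  | append_singleton l a ih =>
    have hz : z * (l ++ [a]).prod ∈ Δ := by
      apply hΔ
      exact wl_le _ fun x hx => hm x (hl x hx)
    have ih' := ih (fun x hx => hl x (by simp [hx])) (fun h hh => hΔ h (by simp; omega))
    have e : pE m Δ (l ++ [a]).length z (z * (l ++ [a]).prod)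
        = ∑' u, pE m Δ l.length z u * m (u⁻¹ * (z * (l ++ [a]).prod)) := by
      rw [List.length_append, List.length_singleton, pE]
      simp only [hz, if_true]
    rw [e]
    refine le_trans ?_ (ENNReal.le_tsum (z * l.prod))
    have e2 : (z * l.prod)⁻¹ * (z * (l ++ [a]).prod) = a := by simp
    rw [e2, List.map_append, List.prod_append]
    simp only [List.map_cons, List.map_nil, List.prod_singleton]
    gcongr

theorem harnack {S : Set Γ} (hS : IsGenSet S) {m : Γ → ℝ≥0∞} (hm : ∀ g, m g ≠ 0 → g ∈ S)
    (hnd : ∀ g : Γ, ∃ l : List Γ, (∀ x ∈ l, m x ≠ 0) ∧ l.prod = g) (M : ℕ) :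
    ∃ (K : ℕ) (A : ℝ≥0∞), A ≠ ⊤ ∧ ∀ (Δ : Set Γ) (z z' : Γ), wl S (z⁻¹ * z') ≤ M →
      (∀ h, wl S (z⁻¹ * h) ≤ K → h ∈ Δ) → ∀ (t : ℝ≥0∞), 1 ≤ t → ∀ w,
        GE m Δ z' w t ≤ A * GE m Δ z w t ∧ GE m Δ w z t ≤ A * GE m Δ w z' t := by
  classical
  choose L hL hLp using hnd
  have hne : (ballF hS M).Nonempty := ⟨1, by rw [mem_ballF, wl_one]; simp⟩
  obtain ⟨g0, hg0, hmin⟩ := (ballF hS M).exists_min_image (fun g => min 1 ((L g).map m).prod) hne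
  set ε := min 1 ((L g0).map m).prod with hε
  have hε0 : ε ≠ 0 := by
    have : 0 < ((L g0).map m).prod := by
      rw [pos_iff_ne_zero]
      apply List.prod_ne_zero
      intro h
      obtain ⟨a, ha, h⟩ := List.mem_map.mp h
      exact hL g0 a ha h
    exact (lt_min one_pos this).ne'
  have hεt : ε ≠ ⊤ := ((min_le_left _ _).trans_lt ENNReal.one_lt_top).ne
  refine ⟨(ballF hS M).sup (fun g => (L g).length), ε⁻¹, ENNReal.inv_ne_top.mpr hε0,
    fun Δ z z' hzz hΔ t ht w => ?_⟩
  have hg : z⁻¹ * z' ∈ ballF hS M := (mem_ballF hS).mpr hzz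
  have hp : ε ≤ pE m Δ (L (z⁻¹ * z')).length z z' := by
    have := pE_list hm (L (z⁻¹ * z')) (hL _) z Δ fun h hh => hΔ _ (by
      rw [inv_mul_cancel_left]
      exact hh.trans (Finset.le_sup (f := fun g => (L g).length) hg))
    rw [hLp, mul_inv_cancel_left] at this
    exact (hmin _ hg).trans ((min_le_right _ _).trans this)
  set k := (L (z⁻¹ * z')).length
  have aux : ∀ a b : ℝ≥0∞, ε * a ≤ b → a ≤ ε⁻¹ * b := fun a b h => by
    calc a = ε⁻¹ * (ε * a) := by rw [← mul_assoc, ENNReal.inv_mul_cancel hε0 hεt, one_mul]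
      _ ≤ _ := by gcongr
  constructor
  · apply aux
    rw [GE, ← ENNReal.tsum_mul_left]
    refine le_trans (ENNReal.tsum_le_tsum fun n => ?_)
      (ENNReal.tsum_comp_le_tsum_of_injective (add_right_injective k) (fun n => pE m Δ n z w * t ^ n))
    rw [← mul_assoc]
    refine mul_le_mul' ((mul_le_mul' hp le_rfl).trans (pE_semigroup m Δ k n z z' w)) ?_
    exact pow_le_pow_right₀ ht (by simp)
  · apply aux
    rw [GE, ← ENNReal.tsum_mul_left]
    refine le_trans (ENNReal.tsum_le_tsum fun n => ?_)
      (ENNReal.tsum_comp_le_tsum_of_injective (add_left_injective k) (fun n => pE m Δ n w z' * t ^ n))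
    rw [← mul_assoc, mul_comm ε]
    refine mul_le_mul' ((mul_le_mul' le_rfl hp).trans (pE_semigroup m Δ n k w z z')) ?_
    exact pow_le_pow_right₀ ht (by simp)

theorem gp_eq {S : Set Γ} (hS : IsGenSet S) (x a b : Γ) :
    gp S x a b = ((wl S (x⁻¹ * a) : ℝ) + wl S (x⁻¹ * b) - wl S (a⁻¹ * b)) / 2 := by
  rw [gp, wdist, wdist, wdist, wl_inv_mul_comm hS a x, wl_inv_mul_comm hS b x]

theorem hyp_base {S : Set Γ} {δ : ℝ} (hδ : IsHyperbolic S δ) (x a b c : Γ) :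
    min (gp S x a c) (gp S x b c) - δ ≤ gp S x a b := by
  rw [gp_base x a c, gp_base x b c, gp_base x a b]
  exact hδ.2 _ _ _

theorem gp_lip {S : Set Γ} (hS : IsGenSet S) (x y a b : Γ) :
    gp S x a y ≤ gp S x b y + wl S (a⁻¹ * b) := by
  rw [gp_eq hS, gp_eq hS]
  have h1 := wl_tri hS x b a
  have h2 := wl_tri hS b a y
  rw [wl_inv_mul_comm hS b a] at h1 h2
  have h1' : (wl S (x⁻¹ * a) : ℝ) ≤ wl S (x⁻¹ * b) + wl S (a⁻¹ * b) := by exact_mod_cast h1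
  have h2' : (wl S (b⁻¹ * y) : ℝ) ≤ wl S (a⁻¹ * b) + wl S (a⁻¹ * y) := by exact_mod_cast h2
  linarith

theorem far_geom {S : Set Γ} {δ : ℝ} (hS : IsGenSet S) (hδ : IsHyperbolic S δ) (x y v z w : Γ) (i : ℕ)
    (hv : wl S (x⁻¹ * v) = i) (hvy : gp S x v y = i) (hz1 : (i:ℝ) - 1 < gp S x z y)
    (hz2 : gp S x z y ≤ i) (hw : (i:ℝ) + δ < gp S x w y) :
    (wl S (z⁻¹ * v) : ℝ) ≤ wl S (z⁻¹ * w) + 2 + 4 * δ := by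
  have h0 := hδ.1
  have h1 : gp S x z w ≤ i + δ := by
    by_contra h
    push Not at h
    have h2 := hyp_base hδ x z y w
    have e : gp S x y w = gp S x w y := by
      rw [gp_eq hS, gp_eq hS, wl_inv_mul_comm hS y w]; ring
    rw [e] at h2
    have : (i:ℝ) + δ < min (gp S x z w) (gp S x w y) := lt_min h hw
    linarith
  have h2 : (i:ℝ) - 1 - δ ≤ gp S x z v := by
    have h3 := hyp_base hδ x z v y
    have : (i:ℝ) - 1 ≤ min (gp S x z y) (gp S x v y) := le_min hz1.le (by linarith)
    linarith
  have h3 : (i:ℝ) ≤ wl S (x⁻¹ * w) := by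
    have h4 := wl_tri hS x w y
    have h4' : (wl S (x⁻¹ * y) : ℝ) ≤ wl S (x⁻¹ * w) + wl S (w⁻¹ * y) := by exact_mod_cast h4
    rw [gp_eq hS] at hw
    linarith
  rw [gp_eq hS] at h1 h2
  rw [hv] at h2
  linarith

theorem exists_kappa (s A : ℝ≥0∞) (hs : 1 < s) (hA : A ≠ ⊤) : ∃ κ : ℕ, 2 * s⁻¹ ^ κ * (A * A) ≤ 1 := by
  have h1 : Tendsto (fun κ : ℕ => (2 * (A * A)) * s⁻¹ ^ κ) atTop (𝓝 (2 * (A * A) * 0)) :=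
    ENNReal.Tendsto.const_mul (ENNReal.tendsto_pow_atTop_nhds_zero_of_lt_one (ENNReal.inv_lt_one.mpr hs))
      (Or.inr (ENNReal.mul_ne_top (by simp) (ENNReal.mul_ne_top hA hA)))
  rw [mul_zero] at h1
  obtain ⟨κ, hκ⟩ := (h1.eventually_lt_const (show (0:ℝ≥0∞) < 1 by simp)).exists
  refine ⟨κ, le_trans (le_of_eq ?_) hκ.le⟩
  ring

theorem ancona {S : Set Γ} {δ : ℝ} (hS : IsGenSet S) (hδ : IsHyperbolic S δ) {m : Γ → ℝ≥0∞}
    (hm : ∀ g, m g ≠ 0 → g ∈ S)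
    (hnd : ∀ g : Γ, ∃ l : List Γ, (∀ x ∈ l, m x ≠ 0) ∧ l.prod = g)
    (s : ℝ≥0∞) (hs : 1 < s) (hst : s ≠ ⊤) :
    ∃ (R0 : ℕ) (C : ℝ≥0∞), 0 < R0 ∧ C ≠ ⊤ ∧ ∀ (x y : Γ) (α : ℕ → Γ) (Δ : Set Γ),
      IsGeodesicSeg S x y α → (∀ i ≤ wdist S x y, ∀ h, wl S ((α i)⁻¹ * h) ≤ R0 → h ∈ Δ) →
      ∀ i ≤ wdist S x y, ∀ w ∈ Δ, (i:ℝ) - 1 < gp S x w y →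
        GE m Δ x w 1 ≤ C * (GE m Δ x (α i) 1 * GE m Δ (α i) w s) := by
  classical
  have hδ0 := hδ.1
  set τ := ⌈1 + δ⌉₊ with hτ
  have hτ1 : 1 + δ ≤ τ := Nat.le_ceil _
  have hτ0 : 1 ≤ τ := by
    have : (1:ℝ) ≤ τ := by linarith
    exact_mod_cast this
  obtain ⟨K1, A1, hA1, H1⟩ := harnack hS hm hnd τ
  obtain ⟨κ, hκ⟩ := exists_kappa s A1 hs hA1
  set ρ := κ + ⌈2 + 4 * δ⌉₊ with hρ
  have hρ1 : (κ : ℝ) + (2 + 4 * δ) ≤ ρ := by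
    rw [hρ, Nat.cast_add]
    linarith [Nat.le_ceil (2 + 4 * δ)]
  obtain ⟨K2, A2, hA2, H2⟩ := harnack hS hm hnd (ρ + τ)
  set B : ℝ≥0∞ := (((ballF hS ρ).card : ℕ) : ℝ≥0∞) with hB
  set D : ℝ≥0∞ := B * (A2 * A2) + A1 * A1 with hD
  have hs1 : (1:ℝ≥0∞) ≤ s := hs.le
  refine ⟨K1 + K2 + ρ + 1, 2 * D, by omega, ?_, ?_⟩
  · refine ENNReal.mul_ne_top (by simp) (ENNReal.add_ne_top.mpr ⟨?_, ENNReal.mul_ne_top hA1 hA1⟩)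
    exact ENNReal.mul_ne_top (by simp [hB]) (ENNReal.mul_ne_top hA2 hA2)
  intro x y α Δ hα hΔ i
  have hx0 : α 0 = x := hα.1
  have hdist : ∀ a b, a ≤ b → b ≤ wdist S x y → wl S ((α a)⁻¹ * α b) = b - a := fun a b hab hb => by
    have := hα.2.2 a b (hab.trans hb) hb
    rwa [wdist, Nat.dist_eq_sub_of_le hab] at this
  have hdist' : ∀ a b, a ≤ b → b ≤ wdist S x y → wl S ((α b)⁻¹ * α a) = b - a := fun a b hab hb => by
    rw [wl_inv_mul_comm hS]; exact hdist a b hab hb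
  induction i using Nat.strong_induction_on with
  | _ i' IH =>
  intro hi' w hw hgw
  by_cases hlt : i' < τ
  · have b0 := H1 Δ (α i') x (by rw [← hx0, hdist' 0 i' (Nat.zero_le _) hi']; omega)
      (fun h hh => hΔ i' hi' h (by omega)) s hs1 w
    have b1 := H1 Δ x (α i') (by rw [← hx0, hdist 0 i' (Nat.zero_le _) hi']; omega)
      (fun h hh => hΔ 0 (Nat.zero_le _) h (by rw [hx0]; omega)) 1 le_rfl x
    have hxΔ : x ∈ Δ := hΔ 0 (Nat.zero_le _) x (by rw [hx0, inv_mul_cancel, wl_one]; omega)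
    have h1 : 1 ≤ A1 * GE m Δ x (α i') 1 := (one_le_GE m Δ x hxΔ 1).trans b1.2
    calc GE m Δ x w 1 ≤ GE m Δ x w s := GE_mono m Δ x w hs1
      _ ≤ A1 * GE m Δ (α i') w s := b0.1
      _ = 1 * (A1 * GE m Δ (α i') w s) := (one_mul _).symm
      _ ≤ (A1 * GE m Δ x (α i') 1) * (A1 * GE m Δ (α i') w s) := by gcongr
      _ = (A1 * A1) * (GE m Δ x (α i') 1 * GE m Δ (α i') w s) := by ring
      _ ≤ 2 * D * (GE m Δ x (α i') 1 * GE m Δ (α i') w s) := by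
        refine mul_le_mul' ?_ le_rfl
        calc A1 * A1 ≤ D := le_add_of_nonneg_left zero_le
          _ = 1 * D := (one_mul _).symm
          _ ≤ 2 * D := by gcongr; norm_num
  · obtain ⟨i, rfl⟩ : ∃ i, i' = i + τ := ⟨i' - τ, by omega⟩
    have hi : i ≤ wdist S x y := by omega
    have IHi := IH i (by omega) hi
    set v := α i with hv
    set v' := α (i + τ) with hv'
    set V : Set Γ := {g | (i:ℝ) < gp S x g y} with hV
    have hgw' : (i:ℝ) + δ < gp S x w y := by
      push_cast at hgw; linarith
    have hwV : w ∈ V := by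
      change (i:ℝ) < gp S x w y
      linarith
    have hxV : x ∉ V := by
      change ¬ (i:ℝ) < gp S x x y
      rw [gp_eq hS, inv_mul_cancel, wl_one]
      have : (0:ℝ) ≤ i := Nat.cast_nonneg i
      push_cast
      linarith
    have hxv : wl S (x⁻¹ * v) = i := by
      rw [← hx0, hv, hdist 0 i (Nat.zero_le _) hi]; omega
    have hvy : gp S x v y = i := by
      have h1 : wl S (v⁻¹ * y) = wdist S x y - i := by
        have := hdist i (wdist S x y) hi le_rfl
        rwa [hα.2.1] at this
      rw [gp_eq hS, h1, hxv, Nat.cast_sub hi, wdist]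
      ring
    have hvV : v ∉ V := by
      change ¬ (i:ℝ) < gp S x v y
      rw [hvy]; exact lt_irrefl _
    have hvv' : wl S (v⁻¹ * v') = τ := by
      rw [hv, hv', hdist i (i + τ) (by omega) hi']; omega
    have hv'v : wl S (v'⁻¹ * v) = τ := by
      rw [wl_inv_mul_comm hS]; exact hvv'
    set X := GE m Δ x v' 1 * GE m Δ v' w s with hX
    let near : Γ → ℝ≥0∞ := fun z => if wl S (v⁻¹ * z) ≤ ρ then 1 else 0
    have key : ∀ z : (Vᶜ : Set Γ), GE m Δ x z 1 * LE m (Δ ∩ V) z w 1 ≤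
        near z * (A2 * A2 * X) +
          (2 * D * s⁻¹ ^ κ * GE m Δ x v 1) * (GE m Δ v z s * LE m (Δ ∩ V) z w s) := by
      rintro ⟨z, hzV⟩
      simp only
      by_cases hzΔ : z ∈ Δ
      swap
      · rw [GE_zero_of_not_mem hzΔ, zero_mul]; exact zero_le
      by_cases hnear : wl S (v⁻¹ * z) ≤ ρ
      · refine le_trans ?_ (le_add_of_nonneg_right zero_le)
        simp only [near, hnear, if_true, one_mul]
        have hzv' : wl S (z⁻¹ * v') ≤ ρ + τ := by
          have := wl_tri hS z v v'
          rw [wl_inv_mul_comm hS z v] at this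
          omega
        have hv'z : wl S (v'⁻¹ * z) ≤ ρ + τ := by rwa [wl_inv_mul_comm hS]
        have c1 := (H2 Δ z v' hzv' (fun h hh => hΔ i hi h (by
          have := wl_tri hS v z h
          rw [← hv]
          omega)) 1 le_rfl x).2
        have c2 := (H2 Δ v' z hv'z (fun h hh => hΔ (i + τ) hi' h (by
          have : wl S ((α (i + τ))⁻¹ * h) ≤ K2 := hh
          omega)) 1 le_rfl w).1
        calc GE m Δ x z 1 * LE m (Δ ∩ V) z w 1 ≤ GE m Δ x z 1 * GE m Δ z w 1 := by
              gcongr; exact LE_le_GE m Δ V z w hzΔ 1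
          _ ≤ (A2 * GE m Δ x v' 1) * (A2 * GE m Δ v' w 1) := by gcongr
          _ ≤ (A2 * GE m Δ x v' 1) * (A2 * GE m Δ v' w s) := by
              gcongr; exact GE_mono m Δ v' w hs1
          _ = _ := by rw [hX]; ring
      · refine le_trans ?_ (le_add_of_nonneg_left zero_le)
        by_cases hL : LE m (Δ ∩ V) z w 1 = 0
        · rw [hL, mul_zero]; exact zero_le
        have hz2 : gp S x z y ≤ i := not_lt.mp hzV
        have hz1 : (i:ℝ) - 1 < gp S x z y := by
          rw [LE, ENNReal.tsum_eq_zero] at hL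
          push Not at hL
          obtain ⟨n, hn⟩ := hL
          obtain ⟨u, hu, hzu⟩ := (lE_dist hS hm (left_ne_zero_of_mul hn)).2
          have h1 := gp_lip hS x y u z
          rw [wl_inv_mul_comm hS] at h1
          have h2 : (wl S (z⁻¹ * u) : ℝ) ≤ 1 := by exact_mod_cast hzu
          have h3 : (i:ℝ) < gp S x u y := hu.2
          linarith
        have hfar := far_geom hS hδ x y v z w i hxv hvy hz1 hz2 hgw'
        have hκd : κ ≤ wl S (z⁻¹ * w) := by
          rw [wl_inv_mul_comm hS z v] at hfar
          push Not at hnear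
          have h1 : (ρ:ℝ) < wl S (v⁻¹ * z) := by exact_mod_cast hnear
          have : (κ:ℝ) ≤ wl S (z⁻¹ * w) := by linarith
          exact_mod_cast this
        calc GE m Δ x z 1 * LE m (Δ ∩ V) z w 1
            ≤ (2 * D * (GE m Δ x v 1 * GE m Δ v z s)) * (s⁻¹ ^ κ * LE m (Δ ∩ V) z w s) := by
              gcongr
              · exact IHi z hzΔ hz1
              · exact LE_shift hS hm hκd hs1 hst
          _ = _ := by ring
    have hnearsum : ∑' z : (Vᶜ : Set Γ), near z ≤ B := by
      refine (ENNReal.tsum_comp_le_tsum_of_injective Subtype.val_injective near).trans ?_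
      have e : ∑' z, near z = ∑' g, near (v * g) := ((Equiv.mulLeft v).tsum_eq near).symm
      rw [e, tsum_eq_sum (s := ballF hS ρ)]
      · refine (Finset.sum_le_card_nsmul _ _ 1 fun g _ => ?_).trans (by simp [hB])
        simp only [near]; split_ifs <;> simp
      · intro g hg
        rw [mem_ballF] at hg
        simp [near, hg]
    have d1 := (H1 Δ v v' hvv'.le (fun h hh => hΔ i hi h (by
          have : wl S ((α i)⁻¹ * h) ≤ K1 := hh
          omega)) 1 le_rfl x).2
    have d2 := (H1 Δ v' v hv'v.le (fun h hh => hΔ (i + τ) hi' h (by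
          have : wl S ((α (i + τ))⁻¹ * h) ≤ K1 := hh
          omega)) s hs1 w).1
    calc GE m Δ x w 1 = ∑' z : (Vᶜ : Set Γ), GE m Δ x z 1 * LE m (Δ ∩ V) z w 1 :=
          lastExit_GE m Δ V x hxV w hwV 1
      _ ≤ ∑' z : (Vᶜ : Set Γ), (near z * (A2 * A2 * X) +
          (2 * D * s⁻¹ ^ κ * GE m Δ x v 1) * (GE m Δ v z s * LE m (Δ ∩ V) z w s)) :=
          ENNReal.tsum_le_tsum key
      _ = (∑' z : (Vᶜ : Set Γ), near z) * (A2 * A2 * X) +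
          (2 * D * s⁻¹ ^ κ * GE m Δ x v 1) * GE m Δ v w s := by
          rw [ENNReal.tsum_add, ENNReal.tsum_mul_right, ENNReal.tsum_mul_left,
            ← lastExit_GE m Δ V v hvV w hwV s]
      _ ≤ B * (A2 * A2 * X) + (2 * D * s⁻¹ ^ κ * (A1 * GE m Δ x v' 1)) * (A1 * GE m Δ v' w s) := by
          gcongr
      _ = (B * (A2 * A2)) * X + (2 * s⁻¹ ^ κ * (A1 * A1)) * (D * X) := by rw [hX]; ring
      _ ≤ D * X + 1 * (D * X) := by
          gcongr
          exact le_add_of_nonneg_right zero_le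
      _ = 2 * D * X := by ring

theorem pE_eq {S : Set Γ} (hS : IsGenSet S) {μ : Γ → ℝ} (hμ : IsRWMeasure S μ) (Δ : Set Γ)
    (n : ℕ) (x y : Γ) :
    pE (fun g => ENNReal.ofReal (μ g)) Δ n x y = ENNReal.ofReal (ptransR μ Δ n x y) := by
  classical
  induction n generalizing y with
  | zero =>
    simp only [pE, ptransR]
    split_ifs <;> simp
  | succ n ih =>
    simp only [pE, ptransR]
    split_ifs
    · rw [ENNReal.ofReal_tsum_of_nonneg (fun z => mul_nonneg (ptransR_nonneg hμ _ _ _ _) (hμ.nonneg _))]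
      · refine tsum_congr fun z => ?_
        rw [ih, ENNReal.ofReal_mul (ptransR_nonneg hμ _ _ _ _)]
      · refine summable_of_finite_support ((hS.1.image (fun g => y * g⁻¹)).subset fun z hz => ?_)
        have : z⁻¹ * y ∈ S := hμ.support_subset _ (right_ne_zero_of_mul hz)
        exact ⟨z⁻¹ * y, this, by simp⟩
    · simp

theorem GE_eq {S : Set Γ} (hS : IsGenSet S) {μ : Γ → ℝ} (hμ : IsRWMeasure S μ) (Δ : Set Γ)
    (x y : Γ) {t : ℝ} (ht : 0 ≤ t) (hsum : Summable (fun n => ptransR μ Δ n x y * t ^ n)) :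
    GE (fun g => ENNReal.ofReal (μ g)) Δ x y (ENNReal.ofReal t) = ENNReal.ofReal (greenRZ μ Δ x y t) := by
  rw [GE, greenRZ, ENNReal.ofReal_tsum_of_nonneg
    (fun n => mul_nonneg (ptransR_nonneg hμ _ _ _ _) (by positivity)) hsum]
  refine tsum_congr fun n => ?_
  rw [pE_eq hS hμ, ENNReal.ofReal_mul (ptransR_nonneg hμ _ _ _ _), ENNReal.ofReal_pow ht]

theorem green_multiplicativity_generating_fn
    (Γ : Type) [Group Γ] (S : Set Γ) (δ : ℝ)
    (hS : IsGenSet S) (hδ : IsHyperbolic S δ) (hne : Nonelementary Γ)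
    (μ : Γ → ℝ) (hμ : IsRWMeasure S μ) :
    ∃ R0 : ℝ, 0 < R0 ∧ ∃ s : ℝ, 1 < s ∧ s * specRad μ < 1 ∧ ∃ C' : ℝ, 1 ≤ C' ∧
      ∀ (x y v : Γ) (α : ℕ → Γ) (Δ : Set Γ), IsGeodesicSeg S x y α →
        (∃ i ≤ wdist S x y, α i = v) → segN S x y α R0 ⊆ Δ →
        ∀ w ∈ Δ ∩ setN S {g : Γ | (wdist S x v : ℝ) < gp S x g y} 1,
          greenR μ Δ x w ≤ C' * greenFR μ Δ x v * greenRZ μ Δ v w s := by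
  obtain ⟨s, hs1, hsr, M, hM⟩ := spectral_summary hS hδ hne hμ
  have hs0 : 0 < s := by linarith
  obtain ⟨R0, C, hR0, hC, H⟩ := ancona hS hδ (m := fun g => ENNReal.ofReal (μ g))
    (fun g hg => hμ.support_subset g fun h => hg (by simp [h]))
    (fun g => by
      obtain ⟨l, -, hl, hp⟩ := hμ.nondeg g
      exact ⟨l, fun x hx => by simpa using hl x hx, hp⟩)
    (ENNReal.ofReal s) (by simpa using hs1) (by simp)
  have hsum1 : ∀ (Δ : Set Γ) (x y : Γ), Summable (fun n => ptransR μ Δ n x y * 1 ^ n) := fun Δ x y =>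
    Summable.of_nonneg_of_le (fun n => mul_nonneg (ptransR_nonneg hμ _ _ _ _) (by simp))
      (fun n => mul_le_mul_of_nonneg_left (by gcongr) (ptransR_nonneg hμ _ _ _ _)) (hM Δ x y).1
  have hgr : ∀ (Δ : Set Γ) (x y : Γ), greenR μ Δ x y = greenRZ μ Δ x y 1 := fun Δ x y => by
    simp [greenR, greenRZ]
  have hnn : ∀ (Δ : Set Γ) (x y : Γ) (t : ℝ), 0 ≤ t → 0 ≤ greenRZ μ Δ x y t := fun Δ x y t ht =>
    tsum_nonneg fun n => mul_nonneg (ptransR_nonneg hμ _ _ _ _) (by positivity)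
  refine ⟨R0, by exact_mod_cast hR0, s, hs1, hsr, max 1 (C.toReal * M), le_max_left _ _, ?_⟩
  rintro x y v α Δ hα ⟨i, hi, rfl⟩ hΔ w ⟨hwΔ, g, hg, hwg⟩
  have hΔ' : ∀ j ≤ wdist S x y, ∀ h, wl S ((α j)⁻¹ * h) ≤ R0 → h ∈ Δ := fun j hj h hh =>
    hΔ ⟨j, hj, by rw [wdist, wl_inv_mul_comm hS]; exact_mod_cast hh⟩
  have hxi : wdist S x (α i) = i := by
    have := hα.2.2 0 i (Nat.zero_le _) hi
    rw [hα.1, Nat.dist_eq_sub_of_le (Nat.zero_le _)] at this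
    omega
  have hgw : (i:ℝ) - 1 < gp S x w y := by
    have h1 : ((wdist S x (α i) : ℕ) : ℝ) < gp S x g y := hg
    rw [hxi] at h1
    have h2 := gp_lip hS x y g w
    rw [wl_inv_mul_comm hS] at h2
    have h3 : (wl S (w⁻¹ * g) : ℝ) ≤ 1 := hwg
    linarith
  have key := H x y α Δ hα hΔ' i hi w hwΔ hgw
  have e1 : ∀ a b, GE (fun g => ENNReal.ofReal (μ g)) Δ a b 1 = ENNReal.ofReal (greenR μ Δ a b) := fun a b => by
    rw [hgr, ← GE_eq hS hμ Δ a b zero_le_one (hsum1 Δ a b), ENNReal.ofReal_one]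
  rw [e1, e1, GE_eq hS hμ Δ _ w hs0.le (hM Δ _ w).1, ← ENNReal.ofReal_toReal hC,
    ← ENNReal.ofReal_mul (by rw [hgr]; exact hnn _ _ _ _ zero_le_one),
    ← ENNReal.ofReal_mul ENNReal.toReal_nonneg, ENNReal.ofReal_le_ofReal_iff] at key
  swap
  · exact mul_nonneg ENNReal.toReal_nonneg (mul_nonneg (by rw [hgr]; exact hnn _ _ _ _ zero_le_one) (hnn _ _ _ _ hs0.le))
  have hvΔ : α i ∈ Δ := hΔ' i hi _ (by rw [inv_mul_cancel, wl_one]; omega)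
  have hvv1 : 1 ≤ greenR μ Δ (α i) (α i) := by
    have := one_le_GE (fun g => ENNReal.ofReal (μ g)) Δ (α i) hvΔ 1
    rw [e1] at this
    simpa using this
  have hvvM : greenR μ Δ (α i) (α i) ≤ M := by
    refine le_trans ?_ (hM Δ (α i) (α i)).2
    rw [hgr]
    refine (hsum1 Δ _ _).tsum_le_tsum (fun n => ?_) (hM Δ (α i) (α i)).1
    exact mul_le_mul_of_nonneg_left (by gcongr) (ptransR_nonneg hμ _ _ _ _)
  have hF : greenR μ Δ x (α i) = greenFR μ Δ x (α i) * greenR μ Δ (α i) (α i) := by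
    rw [greenFR, div_mul_cancel₀]
    linarith
  have hF0 : 0 ≤ greenFR μ Δ x (α i) :=
    div_nonneg (by rw [hgr]; exact hnn _ _ _ _ zero_le_one) (by linarith)
  have hZ := hnn Δ (α i) w s hs0.le
  have hC0 : 0 ≤ C.toReal := ENNReal.toReal_nonneg
  calc greenR μ Δ x w ≤ C.toReal * (greenR μ Δ x (α i) * greenRZ μ Δ (α i) w s) := key
    _ = C.toReal * greenR μ Δ (α i) (α i) * (greenFR μ Δ x (α i) * greenRZ μ Δ (α i) w s) := by
      rw [hF]; ring
    _ ≤ C.toReal * M * (greenFR μ Δ x (α i) * greenRZ μ Δ (α i) w s) := by gcongr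
    _ ≤ max 1 (C.toReal * M) * (greenFR μ Δ x (α i) * greenRZ μ Δ (α i) w s) := by
      gcongr; exact le_max_right _ _
    _ = _ := by ring

end HarmonicBoundary
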